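/- arXiv:1702.01627 — 3 statements merged into one kernel-verified Lean document; each statement's English description precedes it below -/
import Mathlib

section
/- A positive integer n is a sum of three integer squares (i.e. r_3(n) > 0) if and only if n is not of the form 4^a·(8b + 7) for nonnegative integers a and b (the Legendre–Gauss three-square theorem). -/
/-- `r₃ n` is the number of ordered triples `(x,y,z) ∈ ℤ³` with `x² + y² + z² = n`. -/
noncomputable def r3 (n : ℕ) : ℕ :=
  Set.ncard {v : ℤ × ℤ × ℤ | v.1 ^ 2 + v.2.1 ^ 2 + v.2.2 ^ 2 = (n : ℤ)}

theorem Int.exists_two_mul_sub_mul_le {a : ℤ} (ha : 0 < a) (d : ℤ) :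
    ∃ k : ℤ, -a ≤ 2 * (d - k * a) ∧ 2 * (d - k * a) ≤ a := by
  refine ⟨(2 * d + a) / (2 * a), ?_⟩
  have h1 := Int.mul_ediv_add_emod (2 * d + a) (2 * a)
  have h2 := Int.emod_nonneg (2 * d + a) (show 2 * a ≠ 0 by omega)
  have h3 := Int.emod_lt_of_pos (2 * d + a) (show 0 < 2 * a by omega)
  constructor <;> linarith

/-- Lagrange reduction: a positive definite binary form takes a small value at the first column
of a matrix of determinant one. -/
theorem exists_binary_form_le {D : ℤ} (hD : 0 < D) (m : ℕ) :
    ∀ {a b c : ℤ}, a.toNat ≤ m → 0 < a → a * c - b ^ 2 = D →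
      ∃ p q r s : ℤ, p * s - q * r = 1 ∧
        0 < a * p ^ 2 + 2 * b * p * r + c * r ^ 2 ∧
        3 * (a * p ^ 2 + 2 * b * p * r + c * r ^ 2) ^ 2 ≤ 4 * D := by
  induction m with
  | zero => intro a b c hm ha; omega
  | succ m ih =>
    intro a b c hm ha hdet
    by_cases hsmall : 3 * a ^ 2 ≤ 4 * D
    · exact ⟨1, 0, 0, 1, by norm_num, by simpa using ha, by simpa using hsmall⟩
    · obtain ⟨k, hk₁, hk₂⟩ := Int.exists_two_mul_sub_mul_le ha b
      have hdet' : (a * k ^ 2 - 2 * b * k + c) * a - (b - k * a) ^ 2 = D := by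
        linear_combination hdet
      have hsq : 4 * (b - k * a) ^ 2 ≤ a ^ 2 := by nlinarith
      have hlt : a * k ^ 2 - 2 * b * k + c < a := by nlinarith
      have hpos : 0 < a * k ^ 2 - 2 * b * k + c := by
        nlinarith [sq_nonneg (b - k * a)]
      obtain ⟨p, q, r, s, h₁, h₂, h₃⟩ := ih (by omega) hpos hdet'
      have hval : a * (r - k * p) ^ 2 + 2 * b * (r - k * p) * p + c * p ^ 2 =
          (a * k ^ 2 - 2 * b * k + c) * p ^ 2 + 2 * (b - k * a) * p * r + a * r ^ 2 := by ring
      refine ⟨r - k * p, -(s - k * q), p, -q, by linear_combination h₁, ?_, ?_⟩ <;> rwa [hval]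

theorem binary_form_det_one_eq_sq_add_sq {a b c : ℤ} (ha : 0 < a) (hdet : a * c - b ^ 2 = 1)
    (x y : ℤ) : ∃ u v : ℤ, a * x ^ 2 + 2 * b * x * y + c * y ^ 2 = u ^ 2 + v ^ 2 := by
  obtain ⟨p, q, r, s, h₁, h₂, h₃⟩ := exists_binary_form_le one_pos _ le_rfl ha hdet
  have hone : a * p ^ 2 + 2 * b * p * r + c * r ^ 2 = 1 := by nlinarith
  have hx : x = p * (s * x - q * y) + q * (p * y - r * x) := by linear_combination -x * h₁
  have hy : y = r * (s * x - q * y) + s * (p * y - r * x) := by linear_combination -y * h₁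
  generalize s * x - q * y = X at hx hy
  generalize p * y - r * x = Y at hx hy
  set B := a * p * q + b * (p * s + q * r) + c * r * s with hB
  refine ⟨X + B * Y, Y, ?_⟩
  have hC : a * q ^ 2 + 2 * b * q * s + c * s ^ 2 - B ^ 2 = 1 := by
    have : (a * p ^ 2 + 2 * b * p * r + c * r ^ 2) * (a * q ^ 2 + 2 * b * q * s + c * s ^ 2) - B ^ 2
        = (a * c - b ^ 2) * (p * s - q * r) ^ 2 := by rw [hB]; ring
    rwa [hone, hdet, h₁, one_mul, one_pow, mul_one] at this
  rw [hx, hy]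
  linear_combination X ^ 2 * hone + Y ^ 2 * hC

theorem lt_of_hermite_bound {a b d : ℤ} (ha : 2 ≤ a) (hd₁ : -a ≤ 2 * d) (hd₂ : 2 * d ≤ a)
    (h : 3 * (b * a - d ^ 2) ^ 2 ≤ 4 * a) : b < a := by
  by_contra! hle
  have hsq : (2 * d) ^ 2 ≤ a ^ 2 := sq_le_sq' hd₁ hd₂
  have hmul : a * a ≤ b * a := by gcongr
  have hlow : 3 * a ^ 2 ≤ 4 * (b * a - d ^ 2) := by linarith
  have hlow_sq : (3 * a ^ 2) ^ 2 ≤ (4 * (b * a - d ^ 2)) ^ 2 := by gcongr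
  have hcube : 2 ^ 3 ≤ a ^ 3 := by gcongr
  have hquart : 2 ^ 3 * a ≤ a ^ 3 * a := by gcongr
  linarith

/-- Hermite reduction: every value of a positive definite integral ternary form of determinant
one is a sum of three squares. -/
theorem ternary_form_det_one_eq_sum_three_sq (m : ℕ) :
    ∀ {a b c d e f : ℤ}, a.toNat ≤ m → 0 < a → 0 < a * b - d ^ 2 →
      a * b * c + 2 * d * e * f - a * f ^ 2 - b * e ^ 2 - c * d ^ 2 = 1 → ∀ x y z : ℤ,
      ∃ u v w : ℤ, a * x ^ 2 + b * y ^ 2 + c * z ^ 2 + 2 * (d * x * y + e * x * z + f * y * z) =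
        u ^ 2 + v ^ 2 + w ^ 2 := by
  induction m with
  | zero => intro a b c d e f hm ha; omega
  | succ m ih =>
    intro a b c d e f hm ha hminor hdet x y z
    by_cases hone : a = 1
    · subst hone
      obtain ⟨u, v, huv⟩ := binary_form_det_one_eq_sq_add_sq (b := f - d * e) (c := c - e ^ 2)
        hminor (by linear_combination hdet) y z
      exact ⟨x + d * y + e * z, u, v, by linear_combination huv⟩
    obtain ⟨p, q, r, s, h₁, h₂, h₃⟩ := exists_binary_form_le ha _ le_rfl hminor
      (b := a * f - d * e) (c := a * c - e ^ 2) (by linear_combination a * hdet)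
    obtain ⟨k, hk₁, hk₂⟩ := Int.exists_two_mul_sub_mul_le ha (d * p + e * r)
    set d' := d * p + e * r - k * a with hd'
    set b' := b * p ^ 2 + 2 * f * p * r + c * r ^ 2 - 2 * k * (d * p + e * r) + k ^ 2 * a with hb'
    set c' := b * q ^ 2 + 2 * f * q * s + c * s ^ 2 with hc'
    set e' := d * q + e * s with he'
    set f' := b * p * q + f * (p * s + q * r) + c * r * s - k * e' with hf'
    have hminor_eq : (a * b - d ^ 2) * p ^ 2 + 2 * (a * f - d * e) * p * r +
        (a * c - e ^ 2) * r ^ 2 = b' * a - d' ^ 2 := by rw [hb', hd']; ring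
    rw [hminor_eq] at h₂ h₃
    have hdet' : b' * a * c' + 2 * d' * f' * e' - b' * e' ^ 2 - a * f' ^ 2 - c' * d' ^ 2 = 1 := by
      have : b' * a * c' + 2 * d' * f' * e' - b' * e' ^ 2 - a * f' ^ 2 - c' * d' ^ 2 =
          (a * b * c + 2 * d * e * f - a * f ^ 2 - b * e ^ 2 - c * d ^ 2) *
            (p * s - q * r) ^ 2 := by
        rw [hb', hd', hf', he', hc']; ring
      rw [this, hdet, h₁]; norm_num
    have hb_pos : 0 < b' := pos_of_mul_pos_left (by linarith [sq_nonneg d']) ha.le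
    have hb_lt : b' < a := lt_of_hermite_bound (by omega) hk₁ hk₂ h₃
    have hy : y = p * (s * y - q * z) + q * (p * z - r * y) := by linear_combination -y * h₁
    have hz : z = r * (s * y - q * z) + s * (p * z - r * y) := by linear_combination -z * h₁
    generalize s * y - q * z = Y at hy hz
    generalize p * z - r * y = Z at hy hz
    obtain ⟨u, v, w, huvw⟩ := ih (by omega) hb_pos h₂ hdet' Y (x + k * Y) Z
    refine ⟨u, v, w, ?_⟩
    rw [← huvw, hy, hz, hb', hd', hf', he', hc']
    ring

/-- A quadratic residue condition under which the ternary form with matrix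
`!![(h² + b) / t, h, 1; h, t, 0; 1, 0, n]` exhibits `n` as a sum of three squares. -/
theorem eq_sum_three_sq_of_dvd_sq_add {n b t h : ℤ} (hb : 0 < b) (ht : 0 < t)
    (hbn : b * n = t + 1) (hdvd : t ∣ h ^ 2 + b) :
    ∃ x y z : ℤ, n = x ^ 2 + y ^ 2 + z ^ 2 := by
  obtain ⟨m, hm⟩ := hdvd
  have hm_pos : 0 < m := pos_of_mul_pos_right (by rw [← hm]; positivity) ht.le
  obtain ⟨u, v, w, huvw⟩ := ternary_form_det_one_eq_sum_three_sq _ (a := m) (b := t) (c := n)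
    (d := h) (e := 1) (f := 0) le_rfl hm_pos (by linarith)
    (by linear_combination hbn - n * hm) 0 0 1
  exact ⟨u, v, w, by linear_combination huvw⟩

theorem exists_dvd_sq_add_of_jacobiSym {p : ℕ} (hp : p.Prime) {b : ℤ}
    (h : jacobiSym (-b) p = 1) : ∃ k : ℤ, (p : ℤ) ∣ k ^ 2 + b := by
  have : Fact p.Prime := ⟨hp⟩
  obtain ⟨r, hr⟩ := ZMod.isSquare_of_jacobiSym_eq_one h
  refine ⟨r.val, (ZMod.intCast_zmod_eq_zero_iff_dvd _ p).1 ?_⟩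
  push_cast at hr ⊢
  rw [ZMod.natCast_zmod_val]
  linear_combination -hr

theorem exists_prime_eq_four_mul_mul_add {n a : ℕ} (hn : 0 < n) (ha : Odd a)
    (hcop : a.Coprime n) : ∃ p v : ℕ, p.Prime ∧ p = 4 * n * v + a := by
  have hcop' : a.Coprime (4 * n) :=
    Nat.Coprime.mul_right (Nat.Coprime.pow_right 2 ha.coprime_two_right) hcop
  obtain ⟨p, hpa, hp, hmod⟩ := Nat.forall_exists_prime_gt_and_modEq a (by positivity) hcop'
  obtain ⟨v, hv⟩ := (Nat.modEq_iff_dvd' hpa.le).1 hmod.symm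
  exact ⟨p, v, hp, by omega⟩

theorem eq_sum_three_sq_of_mod_four_eq_two {n : ℕ} (hn : n % 4 = 2) :
    ∃ x y z : ℤ, (n : ℤ) = x ^ 2 + y ^ 2 + z ^ 2 := by
  obtain ⟨p, v, hp, hpv⟩ := exists_prime_eq_four_mul_mul_add (n := n) (a := n - 1) (by omega)
    (Nat.odd_iff.2 (by omega)) (Nat.isCoprime_iff_coprime.1 ⟨-1, 1, by
      rw [Nat.cast_sub (by omega)]; push_cast; ring⟩)
  have hp_mod : p % 4 = 1 := by rw [hpv, mul_assoc]; omega
  have hb_mod : (4 * v + 1) % 4 = 1 := by omega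
  have hbn : ((4 * v + 1 : ℕ) : ℤ) * n = p + 1 := by
    rw [hpv]; push_cast [Nat.cast_sub (show 1 ≤ n by omega)]; ring
  have hodd : Odd (4 * v + 1) := Nat.odd_iff.2 (by omega)
  have hp_odd : Odd p := Nat.odd_iff.2 (by omega)
  have hmod : jacobiSym p (4 * v + 1) = jacobiSym (-1) (4 * v + 1) :=
    jacobiSym.mod_left' (Int.modEq_iff_dvd.2 ⟨-n, by linear_combination hbn⟩)
  have hJ : jacobiSym (-((4 * v + 1 : ℕ) : ℤ)) p = 1 := by
    rw [neg_eq_neg_one_mul, jacobiSym.mul_left, jacobiSym.at_neg_one hp_odd,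
      ZMod.χ₄_nat_one_mod_four hp_mod, jacobiSym.quadratic_reciprocity_one_mod_four hb_mod hp_odd,
      hmod, jacobiSym.at_neg_one hodd, ZMod.χ₄_nat_one_mod_four hb_mod, one_mul]
  obtain ⟨k, hk⟩ := exists_dvd_sq_add_of_jacobiSym hp hJ
  exact eq_sum_three_sq_of_dvd_sq_add (by positivity) (mod_cast hp.pos) hbn hk

theorem eq_sum_three_sq_of_mul_eq_two_mul_prime_add_one {n b p : ℕ} (hp : p.Prime)
    (hbn : b * n = 2 * p + 1) (hb : b % 8 = 1 ∨ b % 8 = 3)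
    (hpb : p % 4 = 1 ∨ p % 4 = 3 ∧ b % 4 = 3) :
    ∃ x y z : ℤ, (n : ℤ) = x ^ 2 + y ^ 2 + z ^ 2 := by
  have hb_odd : Odd b := Nat.odd_iff.2 (by omega)
  have hp_odd : Odd p := Nat.odd_iff.2 (by omega)
  have hbn' : (b : ℤ) * n = 2 * p + 1 := mod_cast hbn
  have hneg_two : jacobiSym (-2) b = 1 := by
    rw [jacobiSym.at_neg_two hb_odd, ZMod.χ₈'_nat_eq_if_mod_eight]
    have : b % 2 = 1 := by omega
    simp [this, hb]
  have hpb_one : jacobiSym p b = 1 := by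
    have hmod : jacobiSym (-2 * p) b = jacobiSym 1 b :=
      jacobiSym.mod_left' (Int.modEq_iff_dvd.2 ⟨n, by linear_combination -hbn'⟩)
    rwa [jacobiSym.mul_left, hneg_two, one_mul, jacobiSym.one_left] at hmod
  have hJ : jacobiSym (-(b : ℤ)) p = 1 := by
    rw [neg_eq_neg_one_mul, jacobiSym.mul_left, jacobiSym.at_neg_one hp_odd]
    rcases hpb with h | ⟨h, h'⟩
    · rw [ZMod.χ₄_nat_one_mod_four h, jacobiSym.quadratic_reciprocity_one_mod_four' hb_odd h,
        hpb_one, one_mul]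
    · rw [ZMod.χ₄_nat_three_mod_four h, jacobiSym.quadratic_reciprocity_three_mod_four h' h,
        hpb_one]
      norm_num
  obtain ⟨k, hk⟩ := exists_dvd_sq_add_of_jacobiSym hp hJ
  obtain ⟨k, hk, hk_odd⟩ : ∃ k : ℤ, (p : ℤ) ∣ k ^ 2 + b ∧ Odd k := by
    rcases Int.even_or_odd k with h | h
    · refine ⟨k + p, ?_, h.add_odd (mod_cast hp_odd)⟩
      have : (k + p) ^ 2 + b = (k ^ 2 + b) + p * (2 * k + p) := by ring
      exact this ▸ hk.add (dvd_mul_right _ _)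
    · exact ⟨k, hk, h⟩
  have htwo : (2 : ℤ) ∣ k ^ 2 + b := (hk_odd.pow.add_odd (mod_cast hb_odd)).two_dvd
  have hcop : IsCoprime (2 : ℤ) p := by
    exact_mod_cast Nat.isCoprime_iff_coprime.2 hp_odd.coprime_two_left
  exact eq_sum_three_sq_of_dvd_sq_add (mod_cast hb_odd.pos) (mul_pos two_pos (mod_cast hp.pos))
    hbn' (hcop.mul_dvd htwo hk)

theorem eq_sum_three_sq_of_odd {n : ℕ} (hn : n % 8 = 1 ∨ n % 8 = 3 ∨ n % 8 = 5) :
    ∃ x y z : ℤ, (n : ℤ) = x ^ 2 + y ^ 2 + z ^ 2 := by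
  obtain ⟨c, a, hca, hc⟩ : ∃ c a : ℕ, c * n = 2 * a + 1 ∧
      (c = 1 ∧ a % 4 = 1 ∨ c = 3 ∧ a % 2 = 1) := by
    rcases hn with h | h | h
    · exact ⟨3, (3 * n - 1) / 2, by omega, by omega⟩
    · exact ⟨1, (n - 1) / 2, by omega, by omega⟩
    · exact ⟨3, (3 * n - 1) / 2, by omega, by omega⟩
  have hca' : (c : ℤ) * n = 2 * a + 1 := mod_cast hca
  obtain ⟨p, v, hp, hpv⟩ := exists_prime_eq_four_mul_mul_add (n := n) (a := a) (by omega)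
    (Nat.odd_iff.2 (by omega)) (Nat.isCoprime_iff_coprime.1 ⟨-2, c, by linarith⟩)
  have hpa : p % 4 = a % 4 := by rw [hpv, mul_assoc]; omega
  exact eq_sum_three_sq_of_mul_eq_two_mul_prime_add_one (b := 8 * v + c) hp
    (by rw [hpv]; linear_combination hca) (by omega) (by omega)

theorem eq_sum_three_sq_of_ne {n : ℕ} (hn : 0 < n)
    (h : ¬ ∃ a b : ℕ, n = 4 ^ a * (8 * b + 7)) :
    ∃ x y z : ℤ, (n : ℤ) = x ^ 2 + y ^ 2 + z ^ 2 := by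
  induction n using Nat.strong_induction_on with
  | _ n ih =>
    by_cases h4 : n % 4 = 0
    · obtain ⟨m, rfl⟩ := Nat.dvd_of_mod_eq_zero h4
      obtain ⟨x, y, z, hxyz⟩ := ih m (by omega) (by omega) fun ⟨a, b, hab⟩ =>
        h ⟨a + 1, b, by rw [hab]; ring⟩
      exact ⟨2 * x, 2 * y, 2 * z, by push_cast; rw [hxyz]; ring⟩
    · have h7 : n % 8 ≠ 7 := fun h7 => h ⟨0, n / 8, by omega⟩
      rcases (by omega : n % 4 = 2 ∨ n % 8 = 1 ∨ n % 8 = 3 ∨ n % 8 = 5) with h2 | hodd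
      · exact eq_sum_three_sq_of_mod_four_eq_two h2
      · exact eq_sum_three_sq_of_odd hodd

theorem sum_three_sq_ne {a b : ℕ} (x y z : ℤ) :
    x ^ 2 + y ^ 2 + z ^ 2 ≠ 4 ^ a * (8 * b + 7) := by
  induction a generalizing x y z with
  | zero =>
    intro h
    have hcast := congrArg (Int.cast : ℤ → ZMod 8) h
    push_cast at hcast
    rw [show (8 : ZMod 8) = 0 from rfl, zero_mul, one_mul, zero_add] at hcast
    generalize (x : ZMod 8) = X, (y : ZMod 8) = Y, (z : ZMod 8) = Z at hcast
    revert X Y Z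
    decide
  | succ a ih =>
    intro h
    have sq_mod (t : ℤ) : t % 2 = 0 ∧ t ^ 2 % 4 = 0 ∨ t ^ 2 % 4 = 1 := by
      rcases Int.even_or_odd' t with ⟨k, rfl | rfl⟩
      · exact .inl ⟨by omega, by ring_nf; omega⟩
      · exact .inr (by ring_nf; omega)
    rw [pow_succ' 4 a, mul_assoc] at h
    have hx := sq_mod x
    have hy := sq_mod y
    have hz := sq_mod z
    obtain ⟨x, rfl⟩ : (2 : ℤ) ∣ x := by omega
    obtain ⟨y, rfl⟩ : (2 : ℤ) ∣ y := by omega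
    obtain ⟨z, rfl⟩ : (2 : ℤ) ∣ z := by omega
    exact ih x y z (by linarith)

theorem r3_pos_iff {n : ℕ} :
    0 < r3 n ↔ ∃ x y z : ℤ, (n : ℤ) = x ^ 2 + y ^ 2 + z ^ 2 := by
  have hfin : {v : ℤ × ℤ × ℤ | v.1 ^ 2 + v.2.1 ^ 2 + v.2.2 ^ 2 = (n : ℤ)}.Finite := by
    refine (Set.finite_Icc ((-n, -n, -n) : ℤ × ℤ × ℤ) (n, n, n)).subset ?_
    rintro ⟨x, y, z⟩ h
    have h : x ^ 2 + y ^ 2 + z ^ 2 = (n : ℤ) := h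
    have abs_le_of_sq_le {t : ℤ} (ht : t ^ 2 ≤ n) : -(n : ℤ) ≤ t ∧ t ≤ n :=
      abs_le.1 <| (Int.natAbs_le_self_sq t).trans' (Int.abs_eq_natAbs t).le |>.trans ht
    have hx := abs_le_of_sq_le (t := x) (by nlinarith)
    have hy := abs_le_of_sq_le (t := y) (by nlinarith)
    have hz := abs_le_of_sq_le (t := z) (by nlinarith)
    exact ⟨⟨hx.1, hy.1, hz.1⟩, ⟨hx.2, hy.2, hz.2⟩⟩
  rw [r3, Set.ncard_pos hfin]
  exact ⟨fun ⟨v, hv⟩ => ⟨v.1, v.2.1, v.2.2, Eq.symm hv⟩, fun ⟨x, y, z, h⟩ => ⟨(x, y, z), h.symm⟩⟩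

/-- The Legendre–Gauss three-square theorem: a positive integer is a sum of three integer
squares if and only if it is not of the form `4ᵃ (8b + 7)`. -/
theorem three_square_theorem (n : ℕ) (hn : 0 < n) :
    0 < r3 n ↔ ¬ ∃ a b : ℕ, n = 4 ^ a * (8 * b + 7) := by
  rw [r3_pos_iff]
  refine ⟨?_, eq_sum_three_sq_of_ne hn⟩
  rintro ⟨x, y, z, hxyz⟩ ⟨a, b, rfl⟩
  exact sum_three_sq_ne (a := a) (b := b) x y z (by rw [← hxyz]; push_cast; rfl)
end

section
/- Every nonnegative integer n can be written as a sum of three triangular numbers: there exist nonnegative integers a, b, c with n = a(a+1)/2 + b(b+1)/2 + c(c+1)/2 (Gauss's EYPHKA theorem). -/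
theorem Int.exists_four_mul_add_mul_sq_le (f : ℤ) {a : ℤ} (ha : 0 < a) :
    ∃ k : ℤ, 4 * (f + a * k) ^ 2 ≤ a ^ 2 := by
  refine ⟨-((2 * f + a) / (2 * a)), ?_⟩
  have h₁ := Int.emod_add_mul_ediv (2 * f + a) (2 * a)
  have h₂ := Int.emod_nonneg (2 * f + a) (b := 2 * a) (by lia)
  have h₃ := Int.emod_lt_of_pos (2 * f + a) (b := 2 * a) (by lia)
  have : (2 * (f + a * -((2 * f + a) / (2 * a)))) ^ 2 ≤ a ^ 2 :=
    sq_le_sq' (by linarith) (by linarith)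
  linarith

/-- A positive definite integral binary form of determinant one only takes values that are sums
of two squares. -/
theorem binary_form_eq_sum_two_squares (b d c : ℤ) (hb : 0 < b) (hdet : b * c - d ^ 2 = 1)
    (y z : ℤ) : ∃ s t : ℤ, b * y ^ 2 + 2 * d * y * z + c * z ^ 2 = s ^ 2 + t ^ 2 := by
  obtain ⟨k, hk⟩ := Int.exists_four_mul_add_mul_sq_le d hb
  obtain ⟨d', hd'⟩ : ∃ d', d' = d + b * k := ⟨_, rfl⟩
  obtain ⟨c', hc'⟩ : ∃ c', c' = c + 2 * d * k + b * k ^ 2 := ⟨_, rfl⟩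
  have hdet' : b * c' - d' ^ 2 = 1 := by subst hd' hc'; linear_combination hdet
  rw [← hd'] at hk
  have hc'_pos : 0 < c' := by nlinarith [sq_nonneg d']
  by_cases hlt : c' < b
  · obtain ⟨s, t, h⟩ := binary_form_eq_sum_two_squares c' d' b hc'_pos
      (by linear_combination hdet') z (y - k * z)
    refine ⟨s, t, ?_⟩
    rw [← h, hd', hc']
    ring
  · have hb1 : b = 1 := by nlinarith
    subst hb1
    refine ⟨y + d * z, z, ?_⟩
    linear_combination z ^ 2 * hdet
termination_by b.toNat
decreasing_by lia

/-- A positive definite integral ternary form of determinant one only takes values that are sums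
of three squares. -/
theorem ternary_form_eq_sum_three_squares (a b c d e f : ℤ) (ha : 0 < a)
    (hG : 0 < a * b - f ^ 2)
    (hdet : a * b * c + 2 * d * e * f - a * d ^ 2 - b * e ^ 2 - c * f ^ 2 = 1) (x y z : ℤ) :
    ∃ r s t : ℤ, a * x ^ 2 + b * y ^ 2 + c * z ^ 2 + 2 * d * y * z + 2 * e * x * z
      + 2 * f * x * y = r ^ 2 + s ^ 2 + t ^ 2 := by
  obtain ⟨k, hk⟩ := Int.exists_four_mul_add_mul_sq_le (a * d - e * f) hG
  obtain ⟨c', hc'⟩ : ∃ c', c' = c + 2 * d * k + b * k ^ 2 := ⟨_, rfl⟩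
  obtain ⟨d', hd'⟩ : ∃ d', d' = d + b * k := ⟨_, rfl⟩
  obtain ⟨e', he'⟩ : ∃ e', e' = e + f * k := ⟨_, rfl⟩
  have hdet' : (a * b - f ^ 2) * (a * c' - e' ^ 2)
      - (a * d - e * f + (a * b - f ^ 2) * k) ^ 2 = a := by
    subst hc' he'; linear_combination a * hdet
  have hG' : 0 < a * c' - e' ^ 2 := by
    nlinarith [sq_nonneg (a * d - e * f + (a * b - f ^ 2) * k)]
  by_cases hlt : a * c' - e' ^ 2 < a * b - f ^ 2
  · obtain ⟨r, s, t, h⟩ := ternary_form_eq_sum_three_squares a c' b d' f e' ha hG'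
      (by subst hc' hd' he'; linear_combination hdet) x z (y - k * z)
    refine ⟨r, s, t, ?_⟩
    rw [← h, hc', hd', he']
    ring
  have hG_le : 3 * (a * b - f ^ 2) ^ 2 ≤ 4 * a := by nlinarith
  obtain ⟨l, hl⟩ := Int.exists_four_mul_add_mul_sq_le f ha
  obtain ⟨b', hb'⟩ : ∃ b', b' = b + 2 * f * l + a * l ^ 2 := ⟨_, rfl⟩
  obtain ⟨f', hf'⟩ : ∃ f', f' = f + a * l := ⟨_, rfl⟩
  have hGf : a * b' - f' ^ 2 = a * b - f ^ 2 := by subst hb' hf'; ring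
  rw [← hf'] at hl
  have hb'_pos : 0 < b' := by nlinarith [sq_nonneg f']
  by_cases hlt' : b' < a
  · obtain ⟨r, s, t, h⟩ := ternary_form_eq_sum_three_squares b' a c e (d + e * l) f' hb'_pos
      (by linarith) (by subst hb' hf'; linear_combination hdet) y (x - l * y) z
    refine ⟨r, s, t, ?_⟩
    rw [← h, hb', hf']
    ring
  have ha_sq : 3 * a ^ 2 ≤ 4 * (a * b - f ^ 2) := by nlinarith
  have ha1 : a = 1 := by
    by_contra hne
    have h2 : 2 ≤ a := by lia
    have h3 : (3 * a ^ 2) ^ 2 ≤ (4 * (a * b - f ^ 2)) ^ 2 :=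
      pow_le_pow_left₀ (by positivity) ha_sq 2
    have h4 : 27 * a ^ 4 ≤ 64 * a := by linarith
    have h5 : 8 ≤ a ^ 3 := pow_le_pow_left₀ (a := 2) (by norm_num) h2 3
    nlinarith
  subst ha1
  obtain ⟨s, t, h⟩ := binary_form_eq_sum_two_squares (b - f ^ 2) (d - e * f) (c - e ^ 2)
    (by linarith) (by linear_combination hdet) y z
  refine ⟨x + f * y + e * z, s, t, ?_⟩
  linear_combination h
termination_by (a.toNat, (a * b - f ^ 2).toNat)
decreasing_by
  · exact Prod.Lex.right _ (by lia)
  · exact Prod.Lex.left _ _ (by lia)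

open NumberTheorySymbols in
/-- The auxiliary prime in Dirichlet's proof of the three-square theorem. -/
theorem exists_prime_isSquare_neg (k : ℕ) :
    ∃ p j : ℕ, p.Prime ∧ p % 2 = 1 ∧ 2 * p + 1 = (8 * j + 1) * (8 * k + 3) ∧
      IsSquare ((-(8 * j + 1 : ℤ) : ℤ) : ZMod p) := by
  have hcop : Nat.Coprime (4 * k + 1) (4 * (8 * k + 3)) := by
    rw [← Nat.isCoprime_iff_coprime]
    refine ⟨1 + 8 * k, -k, ?_⟩
    push_cast
    ring
  obtain ⟨p, hgt, hp, hmod⟩ := Nat.forall_exists_prime_gt_and_modEq (4 * k + 1)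
    (by positivity) hcop
  obtain ⟨j, hj⟩ := (Nat.modEq_iff_dvd' hgt.le).1 hmod.symm
  have hpj : p = 4 * (8 * k + 3) * j + (4 * k + 1) := by lia
  have hp4 : p % 4 = 1 := by
    rw [hpj, mul_assoc]; lia
  have hrel : 2 * p + 1 = (8 * j + 1) * (8 * k + 3) := by rw [hpj]; ring
  refine ⟨p, j, hp, by lia, hrel, ?_⟩
  have : Fact p.Prime := ⟨hp⟩
  have hpo : Odd p := Nat.odd_iff.2 (by lia)
  have hbo : Odd (8 * j + 1) := Nat.odd_iff.2 (by lia)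
  apply ZMod.isSquare_of_jacobiSym_eq_one
  have hneg_two : J(-2 | 8 * j + 1) = 1 := by
    rw [jacobiSym.at_neg_two hbo, ZMod.χ₈'_nat_eq_if_mod_eight]
    have h2 : (8 * j + 1) % 2 ≠ 0 := by lia
    have h8 : (8 * j + 1) % 8 = 1 := by lia
    simp [h2, h8]
  have hone : J(-2 * (p : ℤ) | 8 * j + 1) = 1 := by
    rw [← jacobiSym.one_left (8 * j + 1)]
    apply jacobiSym.mod_left'
    apply Int.ModEq.symm
    rw [Int.modEq_iff_dvd]
    refine ⟨-(8 * k + 3), ?_⟩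
    have : (2 * p + 1 : ℤ) = (8 * j + 1) * (8 * k + 3) := by exact_mod_cast hrel
    push_cast
    linear_combination -this
  rw [jacobiSym.mul_left, hneg_two, one_mul, jacobiSym.quadratic_reciprocity_one_mod_four hp4 hbo]
    at hone
  rw [jacobiSym.neg _ hpo, ZMod.χ₄_nat_one_mod_four hp4, one_mul]
  exact_mod_cast hone

theorem eight_mul_add_three_eq_sum_three_squares (k : ℕ) :
    ∃ r s t : ℤ, (8 * k + 3 : ℤ) = r ^ 2 + s ^ 2 + t ^ 2 := by
  obtain ⟨p, j, hp, hodd, hrel, hsq⟩ := exists_prime_isSquare_neg k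
  obtain ⟨w, hw⟩ := hsq
  obtain ⟨v, rfl⟩ := ZMod.intCast_surjective w
  have hdvd (u : ℤ) (hu : (p : ℤ) ∣ u - v) : (p : ℤ) ∣ u ^ 2 + (8 * j + 1) := by
    have hv : (p : ℤ) ∣ v ^ 2 + (8 * j + 1) := by
      rw [← ZMod.intCast_zmod_eq_zero_iff_dvd]
      push_cast at hw ⊢
      linear_combination -hw
    have hsum : u ^ 2 + (8 * j + 1) = (u - v) * (u + v) + (v ^ 2 + (8 * j + 1)) := by ring
    exact hsum ▸ (hu.mul_right (u + v)).add hv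
  obtain ⟨x, hx2, hxp⟩ : ∃ x : ℤ, x % 2 = 1 ∧ (p : ℤ) ∣ x ^ 2 + (8 * j + 1) := by
    rcases Int.emod_two_eq_zero_or_one v with h | h
    · exact ⟨v + p, by lia, hdvd _ (by simp)⟩
    · exact ⟨v, h, hdvd _ (by simp)⟩
  have hx_two : (2 : ℤ) ∣ x ^ 2 + (8 * j + 1) := by
    have : Odd (x ^ 2) := (Int.odd_iff.2 hx2).pow
    have := Int.odd_iff.1 this
    lia
  have hcop : IsCoprime (2 : ℤ) p := by
    rw [Int.isCoprime_iff_gcd_eq_one]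
    exact_mod_cast (Nat.coprime_two_left.2 (Nat.odd_iff.2 hodd))
  obtain ⟨a, ha⟩ := hcop.mul_dvd hx_two hxp
  have hp0 : (0 : ℤ) < p := by exact_mod_cast hp.pos
  have ha0 : 0 < a := by
    have : 0 < 2 * (p : ℤ) * a := by rw [← ha]; positivity
    exact pos_of_mul_pos_right this (by positivity)
  have hrel' : (2 * p + 1 : ℤ) = (8 * j + 1) * (8 * k + 3) := by exact_mod_cast hrel
  obtain ⟨r, s, t, h⟩ := ternary_form_eq_sum_three_squares a (2 * p) (8 * k + 3) 0 1 x ha0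
    (by linarith) (by linear_combination -(8 * k + 3 : ℤ) * ha - hrel') 0 0 1
  exact ⟨r, s, t, by linear_combination h⟩

theorem Int.exists_sq_eq_four_mul_mul_succ_add_one {r : ℤ} (hr : Odd r) :
    ∃ a : ℕ, r ^ 2 = 4 * (a * (a + 1)) + 1 := by
  obtain ⟨a, ha⟩ := Int.natAbs_odd.2 hr
  refine ⟨a, ?_⟩
  rw [← Int.natAbs_sq, ha]
  push_cast
  ring

/-- Gauss's EYPHKA theorem: every nonnegative integer is a sum of three triangular
numbers. -/
theorem sum_of_three_triangular_numbers (n : ℕ) :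
    ∃ a b c : ℕ, n = a * (a + 1) / 2 + b * (b + 1) / 2 + c * (c + 1) / 2 := by
  obtain ⟨r, s, t, h⟩ := eight_mul_add_three_eq_sum_three_squares n
  have hmod (u : ℤ) : Odd u ∨ u ^ 2 % 8 = 0 ∨ u ^ 2 % 8 = 4 := by
    rcases Int.even_or_odd' u with ⟨v, rfl | rfl⟩
    · right
      have : (2 * v) ^ 2 = 4 * v ^ 2 := by ring
      lia
    · exact Or.inl ⟨v, rfl⟩
  have hmod_odd (u : ℤ) (hu : Odd u) : u ^ 2 % 8 = 1 := by
    obtain ⟨a, ha⟩ := Int.exists_sq_eq_four_mul_mul_succ_add_one hu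
    have : (2 : ℤ) ∣ a * (a + 1) := (Int.even_mul_succ_self a).two_dvd
    lia
  have hr : Odd r := by grind
  have hs : Odd s := by grind
  have ht : Odd t := by grind
  obtain ⟨a, ha⟩ := Int.exists_sq_eq_four_mul_mul_succ_add_one hr
  obtain ⟨b, hb⟩ := Int.exists_sq_eq_four_mul_mul_succ_add_one hs
  obtain ⟨c, hc⟩ := Int.exists_sq_eq_four_mul_mul_succ_add_one ht
  refine ⟨a, b, c, ?_⟩
  have ea := (Nat.even_mul_succ_self a).two_dvd
  have eb := (Nat.even_mul_succ_self b).two_dvd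
  have ec := (Nat.even_mul_succ_self c).two_dvd
  have key : 2 * n = a * (a + 1) + b * (b + 1) + c * (c + 1) := by
    zify
    linarith
  lia
end

section
/- For every positive integer n with n ≡ 1 (mod 4), r_3(n) = 6·d(n) + 24·#{(r,s,t) ∈ ℤ³ : r > s > t > 0 and rs + rt + st = n} + 12·#{(r,t) : r,t ≥ 1, r ≠ t, r² + 2rt = n}, where d(n) denotes the number of positive divisors of n. -/
/-- The integral matrix with coordinates `(k, g, t, h)` in the basis `1`, `!![0, -1; 1, 0]`,
`!![1, 0; 0, -1]`, `!![0, 1; 1, 0]`. -/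
def coordMatrix (k g t h : ℤ) : Matrix (Fin 2) (Fin 2) ℤ := !![k + t, h - g; g + h, k - t]

/-- The four reflections in the sides of the ideal quadrilateral with vertices `∞, -1, 0, 1`. -/
def wall (i : ℤˣ × ℤˣ) : Matrix (Fin 2) (Fin 2) ℤ := coordMatrix 0 1 i.1 i.2

lemma det_coordMatrix (k g t h : ℤ) :
    (coordMatrix k g t h).det = k ^ 2 + g ^ 2 - t ^ 2 - h ^ 2 := by
  simp [coordMatrix, Matrix.det_fin_two]; ring

lemma Int.units_sq_coe (e : ℤˣ) : (e : ℤ) * e = 1 := by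
  rcases Int.units_eq_one_or e with rfl | rfl <;> rfl

lemma wall_mul_self (i : ℤˣ × ℤˣ) : wall i * wall i = 1 := by
  obtain ⟨e, f⟩ := i
  rcases Int.units_eq_one_or e with rfl | rfl <;>
  rcases Int.units_eq_one_or f with rfl | rfl <;> decide

lemma det_wall (i : ℤˣ × ℤˣ) : (wall i).det = -1 := by
  rw [wall, det_coordMatrix]
  linear_combination -Int.units_sq_coe i.1 - Int.units_sq_coe i.2

lemma coordMatrix_mul_wall (k g t h : ℤ) (e f : ℤˣ) :
    coordMatrix k g t h * wall (e, f) = coordMatrix (-(g - e * t - f * h)) (k - f * t + e * h)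
      (e * k - f * g + h) (f * k + e * g - t) := by
  ext i j
  fin_cases i <;> fin_cases j <;> simp [coordMatrix, wall, Matrix.mul_apply] <;> ring

lemma wall_mul_coordMatrix_mul_wall (k g t h : ℤ) (e f : ℤˣ) :
    wall (e, f) * coordMatrix k g t h * wall (e, f) =
      -coordMatrix (-k) (g + 2 * (g - e * t - f * h)) (t + 2 * (g - e * t - f * h) * e)
        (h + 2 * (g - e * t - f * h) * f) := by
  rcases Int.units_eq_one_or e with rfl | rfl <;>
  rcases Int.units_eq_one_or f with rfl | rfl <;>
  · ext i j
    fin_cases i <;> fin_cases j <;> simp [coordMatrix, wall, Matrix.mul_apply] <;> ring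

/-- The parity pattern of the matrices met in the reduction, together with their determinant. -/
structure IsState (N k g t h : ℤ) : Prop where
  odd_g : Odd (k + g)
  even_t : Even (k + t)
  even_h : Even (k + h)
  det_eq : Even k ∧ k ^ 2 + g ^ 2 - t ^ 2 - h ^ 2 = N ∨
    Odd k ∧ k ^ 2 + g ^ 2 - t ^ 2 - h ^ 2 = -N

lemma IsState.step {N k g t h : ℤ} (hs : IsState N k g t h) (e f : ℤˣ) :
    IsState N (-(g - e * t - f * h)) (k - f * t + e * h) (e * k - f * g + h)
      (f * k + e * g - t) := by
  obtain ⟨h1, h2, h3, h4⟩ := hs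
  have hdet : (-(g - e * t - f * h)) ^ 2 + (k - f * t + e * h) ^ 2 - (e * k - f * g + h) ^ 2
      - (f * k + e * g - t) ^ 2 = -(k ^ 2 + g ^ 2 - t ^ 2 - h ^ 2) := by
    linear_combination (t ^ 2 + h ^ 2 - k ^ 2 - g ^ 2) * (Int.units_sq_coe e)
      + (t ^ 2 + h ^ 2 - k ^ 2 - g ^ 2) * (Int.units_sq_coe f)
  rw [Int.odd_iff] at h1
  rw [Int.even_iff] at h2 h3
  have hpar : Even (-(g - e * t - f * h)) ↔ Odd k := by
    rw [Int.even_iff, Int.odd_iff]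
    rcases Int.units_eq_one_or e with rfl | rfl <;>
    rcases Int.units_eq_one_or f with rfl | rfl <;> simp <;> omega
  refine ⟨?_, ?_, ?_, ?_⟩
  · rw [Int.odd_iff]
    rcases Int.units_eq_one_or e with rfl | rfl <;>
    rcases Int.units_eq_one_or f with rfl | rfl <;> simp <;> omega
  · rw [Int.even_iff]
    rcases Int.units_eq_one_or e with rfl | rfl <;>
    rcases Int.units_eq_one_or f with rfl | rfl <;> simp <;> omega
  · rw [Int.even_iff]
    rcases Int.units_eq_one_or e with rfl | rfl <;>
    rcases Int.units_eq_one_or f with rfl | rfl <;> simp <;> omega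
  · rw [hdet, hpar, ← Int.not_even_iff_odd (n := -(g - e * t - f * h)), hpar,
      Int.not_odd_iff_even]
    rcases h4 with ⟨h, h'⟩ | ⟨h, h'⟩
    · exact Or.inr ⟨h, by rw [h']⟩
    · exact Or.inl ⟨h, by rw [h']; ring⟩

/-- Some vertex of the quadrilateral is separated from the others by the axis. -/
def AxisCrosses (g t h : ℤ) : Prop := g ^ 2 < t ^ 2 ∨ g ^ 2 < h ^ 2

lemma IsState.sq_ne {N k g t h : ℤ} (hs : IsState N k g t h) : g ^ 2 ≠ t ^ 2 ∧ g ^ 2 ≠ h ^ 2 := by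
  obtain ⟨h1, h2, h3, -⟩ := hs
  rw [Int.odd_iff] at h1
  rw [Int.even_iff] at h2 h3
  constructor
  · intro H
    rcases sq_eq_sq_iff_eq_or_eq_neg.mp H with H | H <;> omega
  · intro H
    rcases sq_eq_sq_iff_eq_or_eq_neg.mp H with H | H <;> omega

/-- The quantity decreased in the reduction. -/
def height (k g t h : ℤ) : ℤ := k ^ 2 - max (k ^ 2 + g ^ 2 - t ^ 2 - h ^ 2) 0

lemma height_step (k g t h : ℤ) (e f : ℤˣ) :
    height (-(g - e * t - f * h)) (k - f * t + e * h) (e * k - f * g + h)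
      (f * k + e * g - t) = height k g t h + 2 * ((g - e * t) * (g - f * h)) := by
  have hdet : (-(g - e * t - f * h)) ^ 2 + (k - f * t + e * h) ^ 2 - (e * k - f * g + h) ^ 2
      - (f * k + e * g - t) ^ 2 = -(k ^ 2 + g ^ 2 - t ^ 2 - h ^ 2) := by
    linear_combination (t ^ 2 + h ^ 2 - k ^ 2 - g ^ 2) * (Int.units_sq_coe e)
      + (t ^ 2 + h ^ 2 - k ^ 2 - g ^ 2) * (Int.units_sq_coe f)
  unfold height
  rw [hdet]
  have := Int.units_sq_coe e
  have := Int.units_sq_coe f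
  rcases le_total (k ^ 2 + g ^ 2 - t ^ 2 - h ^ 2) 0 with H | H
  · rw [max_eq_right H, max_eq_left (by linarith)]
    linear_combination t ^ 2 * Int.units_sq_coe e + h ^ 2 * Int.units_sq_coe f
  · rw [max_eq_left H, max_eq_right (by linarith)]
    linear_combination t ^ 2 * Int.units_sq_coe e + h ^ 2 * Int.units_sq_coe f

lemma IsState.height_pos {N k g t h : ℤ} (hN : 0 < N) (hs : IsState N k g t h)
    (hv : AxisCrosses g t h) : 0 < height k g t h := by
  unfold height
  rcases hs.det_eq with ⟨-, h'⟩ | ⟨ho, h'⟩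
  · rw [max_eq_left (by omega)]
    rcases hv with hv | hv <;> nlinarith [sq_nonneg t, sq_nonneg h]
  · rw [max_eq_right (by omega)]
    have : k ≠ 0 := by rintro rfl; simp at ho
    simpa using sq_pos_of_ne_zero this

/-- A visible state has a wall, crossed by the axis, on the side prescribed by the sign of `k`. -/
lemma IsState.exists_wall {N k g t h : ℤ} (hN : 0 < N) (hs : IsState N k g t h)
    (hv : AxisCrosses g t h) : ∃ e f : ℤˣ, (g - e * t) * (g - f * h) < 0 ∧
      k * (e * f * (g - e * t)) < 0 := by
  have hk : k ≠ 0 := by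
    rintro rfl
    rcases hs.det_eq with ⟨-, h'⟩ | ⟨ho, h'⟩
    · rcases hv with hv | hv <;> nlinarith [sq_nonneg t, sq_nonneg h]
    · simp at ho
  obtain ⟨n1, n2⟩ := hs.sq_ne
  have a1 : g - t ≠ 0 := fun H => n1 (by rw [sub_eq_zero.mp H])
  have a2 : g + t ≠ 0 := fun H => n1 (by rw [eq_neg_of_add_eq_zero_left H]; ring)
  have a3 : g - h ≠ 0 := fun H => n2 (by rw [sub_eq_zero.mp H])
  have a4 : g + h ≠ 0 := fun H => n2 (by rw [eq_neg_of_add_eq_zero_left H]; ring)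
  have hv' : (g - t) * (g + t) < 0 ∨ (g - h) * (g + h) < 0 := by
    rcases hv with hv | hv
    · left; linarith
    · right; linarith
  rcases hk.lt_or_gt with hk | hk <;> rcases a1.lt_or_gt with a1 | a1 <;>
  rcases a2.lt_or_gt with a2 | a2 <;> rcases a3.lt_or_gt with a3 | a3 <;>
  rcases a4.lt_or_gt with a4 | a4 <;>
  first
  | (exfalso; rcases hv' with hv' | hv' <;> nlinarith)
  | (refine ⟨1, 1, ?_, ?_⟩ <;> simp <;> nlinarith)
  | (refine ⟨1, -1, ?_, ?_⟩ <;> simp <;> nlinarith)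
  | (refine ⟨-1, 1, ?_, ?_⟩ <;> simp <;> nlinarith)
  | (refine ⟨-1, -1, ?_, ?_⟩ <;> simp <;> nlinarith)

lemma mul_lt_mul_of_wall_violated {g t h : ℤ} (ht : |t| < g) (hh : |h| < g) (e f e' f' : ℤˣ)
    (h1 : 0 < g - e * t - f * h) (h2 : g - e' * t - f' * h < 0) :
    (g - e' * t) * (g - f' * h) < (g - e * t) * (g - f * h) := by
  obtain ⟨ht1, ht2⟩ := abs_lt.mp ht
  obtain ⟨hh1, hh2⟩ := abs_lt.mp hh
  rcases Int.units_eq_one_or e with rfl | rfl <;>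
  rcases Int.units_eq_one_or f with rfl | rfl <;>
  rcases Int.units_eq_one_or e' with rfl | rfl <;>
  rcases Int.units_eq_one_or f' with rfl | rfl <;> simp at h1 h2 ⊢ <;> nlinarith

lemma IsState.not_axisCrosses {N k g t h : ℤ} (hs : IsState N k g t h) (hv : ¬ AxisCrosses g t h) :
    |t| < |g| ∧ |h| < |g| := by
  obtain ⟨n1, n2⟩ := hs.sq_ne
  unfold AxisCrosses at hv
  push Not at hv
  exact ⟨sq_lt_sq.mp (lt_of_le_of_ne hv.1 n1.symm), sq_lt_sq.mp (lt_of_le_of_ne hv.2 n2.symm)⟩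

lemma exists_unit_mul_eq_abs (x : ℤ) : ∃ e : ℤˣ, (e : ℤ) * x = |x| := by
  rcases abs_cases x with ⟨h, -⟩ | ⟨h, -⟩
  · exact ⟨1, by simp [h]⟩
  · exact ⟨-1, by simp [h]⟩

lemma between_of_sq_le_sq {a b : ℤ} (h : a ^ 2 ≤ b ^ 2) :
    -b ≤ a ∧ a ≤ b ∨ b ≤ a ∧ a ≤ -b := by
  have := sq_le_sq.mp h
  rcases abs_cases b with ⟨h3, h4⟩ | ⟨h3, h4⟩ <;> rw [h3, abs_le] at this <;> omega

/-- The next state beyond a violated wall is visible. -/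
lemma axisCrosses_step {k g t h : ℤ} (ht : |t| < g) (hh : |h| < g) (e f : ℤˣ) :
    AxisCrosses (k - f * t + e * h) (e * k - f * g + h) (f * k + e * g - t) := by
  by_contra hv
  unfold AxisCrosses at hv
  push Not at hv
  obtain ⟨ht1, ht2⟩ := abs_lt.mp ht
  obtain ⟨hh1, hh2⟩ := abs_lt.mp hh
  have h1 := between_of_sq_le_sq hv.1
  have h2 := between_of_sq_le_sq hv.2
  rcases Int.units_eq_one_or e with rfl | rfl <;>
  rcases Int.units_eq_one_or f with rfl | rfl <;> simp at h1 h2 <;> omega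

/-- Up to sign, some product of reflections carries the matrix to a reduced one. -/
def Reduces (N k g t h : ℤ) : Prop :=
  ∃ (l : List (ℤˣ × ℤˣ)) (d : ℤˣ) (k' g' t' h' : ℤ), IsState N k' g' t' h' ∧ Even k' ∧
    |t'| + |h'| < g' ∧
    coordMatrix k g t h * (l.map wall).prod = (d : ℤ) • coordMatrix k' g' t' h'

lemma coordMatrix_neg (k g t h : ℤ) :
    coordMatrix (-k) (-g) (-t) (-h) = -coordMatrix k g t h := by
  ext i j
  fin_cases i <;> fin_cases j <;> simp [coordMatrix] <;> ring

lemma IsState.neg {N k g t h : ℤ} (hs : IsState N k g t h) : IsState N (-k) (-g) (-t) (-h) := by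
  obtain ⟨h1, h2, h3, h4⟩ := hs
  refine ⟨?_, ?_, ?_, ?_⟩
  · rw [← neg_add, Int.odd_iff] at *; omega
  · rw [← neg_add, even_neg]; exact h2
  · rw [← neg_add, even_neg]; exact h3
  · simpa using h4

lemma Reduces.of_neg {N k g t h : ℤ} (hr : Reduces N (-k) (-g) (-t) (-h)) :
    Reduces N k g t h := by
  obtain ⟨l, d, k', g', t', h', h1, h2, h3, h4⟩ := hr
  refine ⟨l, -d, k', g', t', h', h1, h2, h3, ?_⟩
  rw [coordMatrix_neg, neg_mul, neg_eq_iff_eq_neg] at h4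
  rw [h4, Units.val_neg, neg_smul]

lemma Reduces.of_step {N k g t h : ℤ} (e f : ℤˣ)
    (hr : Reduces N (-(g - e * t - f * h)) (k - f * t + e * h) (e * k - f * g + h)
      (f * k + e * g - t)) : Reduces N k g t h := by
  obtain ⟨l, d, k', g', t', h', h1, h2, h3, h4⟩ := hr
  refine ⟨(e, f) :: l, d, k', g', t', h', h1, h2, h3, ?_⟩
  rw [List.map_cons, List.prod_cons, ← mul_assoc, coordMatrix_mul_wall, h4]

lemma IsState.reduces_of_not_axisCrosses {N k g t h : ℤ} (hN : 0 < N) (hs : IsState N k g t h)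
    (ht : |t| < g) (hh : |h| < g)
    (H : ∀ e f : ℤˣ, g - e * t - f * h < 0 → Reduces N (-(g - e * t - f * h))
      (k - f * t + e * h) (e * k - f * g + h) (f * k + e * g - t)) : Reduces N k g t h := by
  have key : (|t| + |h|) ^ 2 = t ^ 2 + h ^ 2 + 2 * (|t| * |h|) := by
    rw [← sq_abs t, ← sq_abs h]; ring
  have hth : 0 ≤ |t| * |h| := by positivity
  have at0 := abs_nonneg t
  have ah0 := abs_nonneg h
  have hodd : Odd k → g < |t| + |h| := by
    intro ho
    rcases hs.det_eq with ⟨he, -⟩ | ⟨-, h'⟩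
    · exact absurd ho (Int.not_odd_iff_even.mpr he)
    · nlinarith [sq_nonneg k]
  rcases lt_trichotomy (|t| + |h|) g with h0 | h0 | h0
  · refine ⟨[], 1, k, g, t, h, hs, ?_, h0, by simp⟩
    by_contra hk
    exact absurd (hodd (Int.not_even_iff_odd.mp hk)) (by omega)
  · exfalso
    have hk : Even k := by
      by_contra hk
      exact absurd (hodd (Int.not_even_iff_odd.mp hk)) (by omega)
    obtain ⟨h1, h2, h3, -⟩ := hs
    rw [Int.odd_iff] at h1
    rw [Int.even_iff] at h2 h3 hk
    rcases abs_cases t with ⟨h5, -⟩ | ⟨h5, -⟩ <;>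
    rcases abs_cases h with ⟨h6, -⟩ | ⟨h6, -⟩ <;> omega
  · obtain ⟨e, he⟩ := exists_unit_mul_eq_abs t
    obtain ⟨f, hf⟩ := exists_unit_mul_eq_abs h
    exact .of_step e f (H e f (by rw [he, hf]; omega))

lemma AxisCrosses.neg {g t h : ℤ} (hv : AxisCrosses g t h) : AxisCrosses (-g) (-t) (-h) := by
  simpa [AxisCrosses] using hv

lemma height_neg (k g t h : ℤ) : height (-k) (-g) (-t) (-h) = height k g t h := by
  simp [height]

lemma IsState.reduces_of_axisCrosses {N : ℤ} (hN : 0 < N) (n : ℕ) : ∀ {k g t h : ℤ},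
    IsState N k g t h → AxisCrosses g t h → height k g t h < n → Reduces N k g t h := by
  induction n with
  | zero =>
    intro k g t h hs hv hn
    exact absurd (hs.height_pos hN hv) (by simpa using hn.le)
  | succ n ih =>
    intro k g t h hs hv hn
    push_cast at hn
    obtain ⟨e, f, hq, hk⟩ := hs.exists_wall hN hv
    suffices H : ∀ {k g t h : ℤ}, IsState N k g t h → height k g t h < n + 1 →
        (g - e * t) * (g - f * h) < 0 → k * (e * f * (g - e * t)) < 0 →
        0 ≤ k - f * t + e * h → Reduces N k g t h by
      rcases le_total 0 (k - f * t + e * h) with h0 | h0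
      · exact H hs hn hq hk h0
      · refine .of_neg (H hs.neg (by rwa [height_neg]) ?_ ?_ ?_)
        · convert hq using 1; ring
        · convert hk using 1; ring
        · linarith
    clear hn hk hq hv hs
    intro k g t h hs hn hq hk h0
    refine .of_step e f ?_
    have hB := hs.step e f
    have hheight := height_step k g t h e f
    by_cases hv : AxisCrosses (k - f * t + e * h) (e * k - f * g + h) (f * k + e * g - t)
    · exact ih hB hv (by rw [hheight]; linarith)
    · obtain ⟨ht, hh⟩ := hB.not_axisCrosses hv
      rw [abs_of_nonneg h0] at ht hh
      refine hB.reduces_of_not_axisCrosses hN ht hh fun e' f' hm => ?_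
      refine ih (hB.step e' f') (axisCrosses_step ht hh e' f') ?_
      rw [height_step, hheight]
      have hee := Int.units_sq_coe e
      have hff := Int.units_sq_coe f
      have c1 : (k - f * t + e * h) - e * (e * k - f * g + h) = e * f * (g - e * t) := by
        linear_combination (f * t - k) * hee
      have c2 : (k - f * t + e * h) - f * (f * k + e * g - t) = -(e * f * (g - f * h)) := by
        linear_combination (-k - e * h) * hff
      have hp : 0 < (k - f * t + e * h) - e * (e * k - f * g + h) - f * (f * k + e * g - t) := by
        have h3 : (k - f * t + e * h) - e * (e * k - f * g + h) - f * (f * k + e * g - t) = -k := by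
          linear_combination (-k) * hee - k * hff
        rw [h3]
        have h4 : 0 < e * f * (g - e * t) := by
          rw [← c1]
          have := abs_lt.mp ht
          rcases Int.units_eq_one_or e with rfl | rfl <;> simp at this ⊢ <;> linarith
        have : k < 0 := by
          by_contra h5
          exact absurd hk (not_lt.mpr (mul_nonneg (not_lt.mp h5) h4.le))
        linarith
      have := mul_lt_mul_of_wall_violated ht hh e f e' f' hp hm
      rw [c1, c2] at this
      have h7 : (e * f * (g - e * t)) * -(e * f * (g - f * h)) = -((g - e * t) * (g - f * h)) := by
        linear_combination (-((g - e * t) * (g - f * h)) * f * f) * hee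
          - ((g - e * t) * (g - f * h)) * hff
      rw [h7] at this
      linarith

theorem IsState.reduces {N k g t h : ℤ} (hN : 0 < N) (hs : IsState N k g t h) :
    Reduces N k g t h := by
  have main : ∀ {k g t h : ℤ}, IsState N k g t h → AxisCrosses g t h → Reduces N k g t h :=
    fun {k g t h} hs hv => hs.reduces_of_axisCrosses hN ((height k g t h).toNat + 1) hv (by
      push_cast; omega)
  by_cases hv : AxisCrosses g t h
  · exact main hs hv
  · have aux : ∀ {k g t h : ℤ}, IsState N k g t h → |t| < g → |h| < g → Reduces N k g t h :=
      fun hs ht hh => hs.reduces_of_not_axisCrosses hN ht hh fun e f _ =>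
        main (hs.step e f) (axisCrosses_step ht hh e f)
    obtain ⟨ht, hh⟩ := hs.not_axisCrosses hv
    rcases le_total 0 g with h0 | h0
    · rw [abs_of_nonneg h0] at ht hh
      exact aux hs ht hh
    · rw [abs_of_nonpos h0] at ht hh
      exact .of_neg (aux hs.neg (by rwa [abs_neg]) (by rwa [abs_neg]))

lemma wall_pos_of_wall_neg {g t h : ℤ} (hg : 0 < g) (hY : t ^ 2 + h ^ 2 < g ^ 2)
    {i j : ℤˣ × ℤˣ} (hij : i ≠ j) (hi : g - i.1 * t - i.2 * h < 0) :
    0 < g - j.1 * t - j.2 * h := by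
  have h1 := abs_lt_of_sq_lt_sq (by nlinarith [sq_nonneg h] : t ^ 2 < g ^ 2) hg.le
  have h2 := abs_lt_of_sq_lt_sq (by nlinarith [sq_nonneg t] : h ^ 2 < g ^ 2) hg.le
  rw [abs_lt] at h1 h2
  obtain ⟨e, f⟩ := i
  obtain ⟨e', f'⟩ := j
  rcases Int.units_eq_one_or e with rfl | rfl <;>
  rcases Int.units_eq_one_or f with rfl | rfl <;>
  rcases Int.units_eq_one_or e' with rfl | rfl <;>
  rcases Int.units_eq_one_or f' with rfl | rfl <;> simp at hij hi ⊢ <;> omega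

lemma wall_pos_of_reduced {g t h : ℤ} (hr : |t| + |h| < g) (i : ℤˣ × ℤˣ) :
    0 < g - i.1 * t - i.2 * h := by
  obtain ⟨e, f⟩ := i
  have h1 := le_abs_self t
  have h2 := neg_abs_le t
  have h3 := le_abs_self h
  have h4 := neg_abs_le h
  rcases Int.units_eq_one_or e with rfl | rfl <;>
  rcases Int.units_eq_one_or f with rfl | rfl <;> simp <;> omega

lemma prod_wall_mul_prod_reverse (l : List (ℤˣ × ℤˣ)) :
    (l.map wall).prod * (l.reverse.map wall).prod = 1 := by
  induction l with
  | nil => simp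
  | cons i l ih =>
    simp only [List.map_cons, List.prod_cons, List.reverse_cons, List.map_append, List.prod_append,
      List.map_nil, List.prod_nil, mul_one]
    rw [mul_assoc, ← mul_assoc _ _ (wall i), ih, one_mul, wall_mul_self]

lemma det_prod_wall (l : List (ℤˣ × ℤˣ)) : (l.map wall).prod.det = (-1) ^ l.length := by
  induction l with
  | nil => simp
  | cons i l ih => simp [Matrix.det_mul, det_wall, ih, pow_succ]

lemma exists_isChain_prod_wall (l : List (ℤˣ × ℤˣ)) :
    ∃ l' : List (ℤˣ × ℤˣ), l'.IsChain (· ≠ ·) ∧ (l'.map wall).prod = (l.map wall).prod := by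
  induction l with
  | nil => exact ⟨[], List.isChain_nil, rfl⟩
  | cons i l ih =>
    obtain ⟨l', h1, h2⟩ := ih
    rw [List.map_cons, List.prod_cons, ← h2]
    cases l' with
    | nil => exact ⟨[i], List.isChain_singleton i, by simp⟩
    | cons j l' =>
      by_cases hij : i = j
      · subst hij
        refine ⟨l', h1.tail, ?_⟩
        rw [List.map_cons, List.prod_cons, ← mul_assoc, wall_mul_self, one_mul]
      · exact ⟨i :: j :: l', List.isChain_cons_cons.mpr ⟨hij, h1⟩, by simp⟩

/-- Ping-pong: a reduced word of reflections moves a point of the quadrilateral away from any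
other point of the quadrilateral. -/
lemma exists_conj_prod_wall {g₀ t₀ h₀ k₁ g₁ t₁ h₁ : ℤ} (hr₀ : |t₀| + |h₀| < g₀)
    (hr₁ : |t₁| + |h₁| < g₁) (l : List (ℤˣ × ℤˣ)) (hl : l.IsChain (· ≠ ·)) :
    ∃ k g t h : ℤ, (l.map wall).prod * coordMatrix k₁ g₁ t₁ h₁ * (l.reverse.map wall).prod =
        ((-1) ^ l.length : ℤ) • coordMatrix k g t h ∧ 0 < g ∧ t ^ 2 + h ^ 2 < g ^ 2 ∧
      (∀ i, (∀ j ∈ l.head?, i ≠ j) → 0 < g - i.1 * t - i.2 * h) ∧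
      (g₀ * g₁ - t₀ * t₁ - h₀ * h₁ ≤ g₀ * g - t₀ * t - h₀ * h) ∧
      (l ≠ [] → g₀ * g₁ - t₀ * t₁ - h₀ * h₁ < g₀ * g - t₀ * t - h₀ * h) := by
  induction l with
  | nil =>
    have := abs_nonneg t₁
    have := abs_nonneg h₁
    refine ⟨k₁, g₁, t₁, h₁, by simp, by omega, ?_, fun i _ => wall_pos_of_reduced hr₁ i, le_rfl,
      by simp⟩
    rw [← sq_abs t₁, ← sq_abs h₁]
    nlinarith [mul_nonneg (abs_nonneg t₁) (abs_nonneg h₁)]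
  | cons i l ih =>
    obtain ⟨hi, hl'⟩ := List.isChain_cons.mp hl
    obtain ⟨k, g, t, h, h1, h2, h3, h4, h5, -⟩ := ih hl'
    have hp := h4 i hi
    have hp₀ := wall_pos_of_reduced hr₀ i
    obtain ⟨e, f⟩ := i
    simp only at hp hp₀
    have hee := Int.units_sq_coe e
    have hff := Int.units_sq_coe f
    set p := g - e * t - f * h with hpdef
    have h3' : (t + 2 * p * e) ^ 2 + (h + 2 * p * f) ^ 2 < (g + 2 * p) ^ 2 := by
      have : (g + 2 * p) ^ 2 - (t + 2 * p * e) ^ 2 - (h + 2 * p * f) ^ 2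
          = g ^ 2 - t ^ 2 - h ^ 2 := by
        rw [hpdef]
        linear_combination (-4 * (g - e * t - f * h) ^ 2) * hee
          - 4 * (g - e * t - f * h) ^ 2 * hff
      linarith
    have hneg : (g + 2 * p) - e * (t + 2 * p * e) - f * (h + 2 * p * f) < 0 := by
      have : (g + 2 * p) - e * (t + 2 * p * e) - f * (h + 2 * p * f) = -p := by
        rw [hpdef]
        linear_combination (-2 * (g - e * t - f * h)) * hee - 2 * (g - e * t - f * h) * hff
      linarith
    have hlt : g₀ * g₁ - t₀ * t₁ - h₀ * h₁ <
        g₀ * (g + 2 * p) - t₀ * (t + 2 * p * e) - h₀ * (h + 2 * p * f) := by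
      have : 0 < p * (g₀ - e * t₀ - f * h₀) := mul_pos hp hp₀
      linarith
    refine ⟨-k, g + 2 * p, t + 2 * p * e, h + 2 * p * f, ?_, by linarith, h3', ?_, hlt.le,
      fun _ => hlt⟩
    · simp only [List.map_cons, List.prod_cons, List.reverse_cons, List.map_append,
        List.prod_append, List.map_nil, List.prod_nil, mul_one, List.length_cons]
      rw [show ∀ a b c d e : Matrix (Fin 2) (Fin 2) ℤ, a * b * c * (d * e) = a * (b * c * d) * e by
        intros; simp only [mul_assoc], h1, mul_smul_comm, smul_mul_assoc,
        wall_mul_coordMatrix_mul_wall, smul_neg, pow_succ, mul_neg, mul_one, neg_smul]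
    · intro j hj
      refine wall_pos_of_wall_neg (i := (e, f)) (by linarith) h3' ?_ hneg
      exact (hj _ (by simp)).symm

lemma coordMatrix_injective {k g t h k' g' t' h' : ℤ}
    (H : coordMatrix k g t h = coordMatrix k' g' t' h') : k = k' ∧ g = g' ∧ t = t' ∧ h = h' := by
  have h00 := congrFun (congrFun H 0) 0
  have h01 := congrFun (congrFun H 0) 1
  have h10 := congrFun (congrFun H 1) 0
  have h11 := congrFun (congrFun H 1) 1
  simp [coordMatrix] at h00 h01 h10 h11
  omega

lemma trace_coordMatrix (k g t h : ℤ) : (coordMatrix k g t h).trace = 2 * k := by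
  simp [coordMatrix, Matrix.trace_fin_two]; ring

lemma trace_coordMatrix_mul (k g t h k' g' t' h' : ℤ) :
    (coordMatrix k g t h * coordMatrix k' g' t' h').trace =
      2 * (k * k' - (g * g' - t * t' - h * h')) := by
  simp [coordMatrix, Matrix.trace_fin_two]; ring

/-- Two equivalent reduced matrices coincide. -/
theorem eq_of_reduced {N k g t h k' g' t' h' : ℤ} (hN : 0 < N)
    (hN₀ : k ^ 2 + g ^ 2 - t ^ 2 - h ^ 2 = N) (hN₁ : k' ^ 2 + g' ^ 2 - t' ^ 2 - h' ^ 2 = N)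
    (hr₀ : |t| + |h| < g) (hr₁ : |t'| + |h'| < g') (l : List (ℤˣ × ℤˣ)) (d : ℤˣ)
    (H : coordMatrix k' g' t' h' = (d : ℤ) • (coordMatrix k g t h * (l.map wall).prod)) :
    coordMatrix k' g' t' h' = coordMatrix k g t h := by
  obtain ⟨l, hl, hl'⟩ := exists_isChain_prod_wall l
  rw [← hl'] at H
  have hdd := Int.units_sq_coe d
  obtain ⟨K, G, T, S, h1, -, -, -, -, h6⟩ := exists_conj_prod_wall (k₁ := k') hr₀ hr₁ l hl
  have hsign : ((-1) ^ l.length : ℤ) = 1 := by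
    have := congrArg Matrix.det H
    rw [Matrix.det_smul, Matrix.det_mul, det_coordMatrix, det_coordMatrix, det_prod_wall, hN₀, hN₁,
      Fintype.card_fin, pow_two, hdd, one_mul] at this
    exact (mul_eq_left₀ hN.ne').mp this.symm
  rw [hsign, one_smul] at h1
  have hY : coordMatrix K G T S = (d : ℤ) • ((l.map wall).prod * coordMatrix k g t h) := by
    rw [← h1, H, mul_smul_comm, smul_mul_assoc, mul_assoc, mul_assoc,
      prod_wall_mul_prod_reverse, mul_one]
  have hK : K = k' := by
    have h2 := congrArg Matrix.trace hY
    have h3 := congrArg Matrix.trace H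
    rw [Matrix.trace_smul, Matrix.trace_mul_comm, ← Matrix.trace_smul, ← h3, trace_coordMatrix,
      trace_coordMatrix] at h2
    omega
  have hb : k * K - (g * G - t * T - h * S) = k * k' - (g * g' - t * t' - h * h') := by
    have h2 : (coordMatrix k g t h * coordMatrix K G T S).trace =
        (coordMatrix k g t h * coordMatrix k' g' t' h').trace := by
      rw [hY, mul_smul_comm, ← mul_assoc, ← smul_mul_assoc, ← H, Matrix.trace_mul_comm]
    rw [trace_coordMatrix_mul, trace_coordMatrix_mul] at h2
    omega
  have hnil : l = [] := by
    by_contra hne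
    have := h6 hne
    rw [hK] at hb
    linarith
  subst hnil
  simp only [List.map_nil, List.prod_nil, mul_one] at H
  rcases Int.units_eq_one_or d with rfl | rfl
  · simpa using H
  · exfalso
    simp only [Units.val_neg, Units.val_one, neg_smul, one_smul, ← coordMatrix_neg] at H
    have := abs_nonneg t
    have := abs_nonneg h
    have := abs_nonneg t'
    have := abs_nonneg h'
    have := (coordMatrix_injective H).2.1
    omega

section

open Matrix

lemma exists_prod_wall_of_isState {k g t h : ℤ} {N : ℤ} (hs : IsState N k g t h) (hk : Even k)
    {k' g' t' h' : ℤ} (hs' : IsState N k' g' t' h') (hk' : Even k')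
    {γ : Matrix (Fin 2) (Fin 2) ℤ} (hγ : γ.det = 1)
    (H : coordMatrix k' g' t' h' = coordMatrix k g t h * γ) :
    ∃ (l : List (ℤˣ × ℤˣ)) (d : ℤˣ), γ = (d : ℤ) • (l.map wall).prod := by
  obtain ⟨p, q, r, s, rfl⟩ : ∃ p q r s, γ = !![p, q; r, s] := ⟨_, _, _, _, Matrix.eta_fin_two γ⟩
  rw [Matrix.det_fin_two_of] at hγ
  have h00 := congrFun (congrFun H 0) 0
  have h01 := congrFun (congrFun H 0) 1
  have h10 := congrFun (congrFun H 1) 0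
  have h11 := congrFun (congrFun H 1) 1
  simp [coordMatrix, Matrix.mul_apply] at h00 h01 h10 h11
  obtain ⟨g1, t1, e1, -⟩ := hs
  obtain ⟨g2, t2, e2, -⟩ := hs'
  obtain ⟨K, rfl⟩ := hk
  obtain ⟨K', rfl⟩ := hk'
  obtain ⟨G, rfl⟩ : ∃ G, g = 2 * G + 1 := by obtain ⟨x, hx⟩ := g1; exact ⟨x - K, by omega⟩
  obtain ⟨G', rfl⟩ : ∃ G, g' = 2 * G + 1 := by obtain ⟨x, hx⟩ := g2; exact ⟨x - K', by omega⟩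
  obtain ⟨T, rfl⟩ : ∃ G, t = 2 * G := by obtain ⟨x, hx⟩ := t1; exact ⟨x - K, by omega⟩
  obtain ⟨T', rfl⟩ : ∃ G, t' = 2 * G := by obtain ⟨x, hx⟩ := t2; exact ⟨x - K', by omega⟩
  obtain ⟨S, rfl⟩ : ∃ G, h = 2 * G := by obtain ⟨x, hx⟩ := e1; exact ⟨x - K, by omega⟩
  obtain ⟨S', rfl⟩ : ∃ G, h' = 2 * G := by obtain ⟨x, hx⟩ := e2; exact ⟨x - K', by omega⟩
  obtain ⟨r, rfl⟩ : ∃ r', r = 2 * r' :=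
    ⟨K' + T' - (K + T) * p - (S - G - 1) * r, by linear_combination - h00⟩
  obtain ⟨q, rfl⟩ : ∃ q', q = 2 * q' :=
    ⟨K' - T' - (K - T) * s - (G + S) * q, by linear_combination - h11⟩
  have hps : Odd (p * s) := ⟨2 * (q * r), by linear_combination hγ⟩
  obtain ⟨⟨p, rfl⟩, ⟨s, rfl⟩⟩ := Int.odd_mul.1 hps
  have hps : Even (p + s) := ⟨q * r * 2 - p * s - q * r, by linarith⟩
  have hqr : Even (q + r) :=
    ⟨K + (K + T) * p + (K - T) * s + (S - G) * r + (G + S) * q - K' + q, by linarith⟩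
  obtain ⟨x, hx⟩ := hps
  obtain ⟨y, hy⟩ := hqr
  obtain rfl : s = x + x - p := by omega
  obtain rfl : r = y + y - q := by omega
  have hst : IsState 1 (2 * (q - y)) (2 * x + 1) (-2 * y) (2 * (p - x)) := by
    refine ⟨⟨q - y + x, by ring⟩, ⟨q - 2 * y, by ring⟩, ⟨q - y + p - x, by ring⟩,
      .inl ⟨⟨q - y, by ring⟩, ?_⟩⟩
    linear_combination hγ
  obtain ⟨l, d, k', g', t', h', ⟨-, -, -, hd⟩, hk', hr, hl⟩ := hst.reduces one_pos
  replace hd := (hd.resolve_right fun h => Int.not_odd_iff_even.2 hk' h.1).2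
  have hge : (|t'| + |h'| + 1) ^ 2 ≤ g' ^ 2 := pow_le_pow_left₀ (by positivity) hr 2
  have hz : k' = 0 ∧ t' = 0 ∧ h' = 0 ∧ g' = 1 := by
    have h1 : |t'| + |h'| = 0 := by
      nlinarith [abs_nonneg t', abs_nonneg h', sq_abs t', sq_abs h', sq_nonneg k',
        mul_nonneg (abs_nonneg t') (abs_nonneg h')]
    have h2 : t' = 0 := by
      rw [← abs_eq_zero]; linarith [abs_nonneg t', abs_nonneg h']
    have h3 : h' = 0 := by
      rw [← abs_eq_zero]; linarith [abs_nonneg t', abs_nonneg h']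
    subst h2 h3
    simp only [abs_zero, add_zero] at hr
    have h4 : k' = 0 := pow_eq_zero_iff (two_ne_zero) |>.1 (by nlinarith [sq_nonneg k'])
    subst h4
    exact ⟨rfl, rfl, rfl, by nlinarith⟩
  obtain ⟨rfl, rfl, rfl, rfl⟩ := hz
  refine ⟨l.reverse, d, ?_⟩
  have hJ : coordMatrix 0 1 0 0 * coordMatrix 0 1 0 0 = -1 := by decide
  have hγ' : coordMatrix (2 * (q - y)) (2 * x + 1) (-2 * y) (2 * (p - x)) =
      coordMatrix 0 1 0 0 * !![2 * p + 1, 2 * q; 2 * (y + y - q), 2 * (x + x - p) + 1] := by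
    ext i j
    fin_cases i <;> fin_cases j <;> simp [coordMatrix, Matrix.mul_apply] <;> ring
  rw [hγ', mul_assoc] at hl
  replace hl := congrArg (fun M => -(coordMatrix 0 1 0 0 * M * (l.reverse.map wall).prod)) hl
  simp only [← mul_assoc, mul_smul_comm, hJ, smul_mul_assoc] at hl
  rw [mul_assoc, prod_wall_mul_prod_reverse] at hl
  simpa only [neg_mul, one_mul, mul_one, smul_neg, neg_neg] using hl

/-- Reduced matrices in the same right coset of `SL₂(ℤ)` coincide. -/
theorem eq_of_reduced_of_mul {N k g t h k' g' t' h' : ℤ} (hN : 0 < N)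
    (hs : IsState N k g t h) (hk : Even k) (hs' : IsState N k' g' t' h') (hk' : Even k')
    (hr₀ : |t| + |h| < g) (hr₁ : |t'| + |h'| < g')
    {γ : Matrix (Fin 2) (Fin 2) ℤ} (hγ : γ.det = 1)
    (H : coordMatrix k' g' t' h' = coordMatrix k g t h * γ) :
    k' = k ∧ g' = g ∧ t' = t ∧ h' = h := by
  obtain ⟨l, d, rfl⟩ := exists_prod_wall_of_isState hs hk hs' hk' hγ H
  have hd := (hs.det_eq.resolve_right fun h => Int.not_odd_iff_even.2 hk h.1).2
  have hd' := (hs'.det_eq.resolve_right fun h => Int.not_odd_iff_even.2 hk' h.1).2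
  exact coordMatrix_injective
    (eq_of_reduced hN hd hd' hr₀ hr₁ l d (by rw [H, mul_smul_comm]))

/-- Even states satisfying the reducedness inequality. -/
def reducedSet (N : ℤ) : Set (ℤ × ℤ × ℤ × ℤ) :=
  {v | Even v.1 ∧ Odd v.2.1 ∧ Even v.2.2.1 ∧ Even v.2.2.2 ∧ |v.2.2.1| + |v.2.2.2| < v.2.1 ∧
    v.1 ^ 2 + v.2.1 ^ 2 - v.2.2.1 ^ 2 - v.2.2.2 ^ 2 = N}

lemma isState_of_mem_reducedSet {N k g t h : ℤ} (hv : (k, g, t, h) ∈ reducedSet N) :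
    IsState N k g t h := by
  obtain ⟨h1, h2, h3, h4, -, h6⟩ := hv
  exact ⟨h1.add_odd h2, h1.add h3, h1.add h4, .inl ⟨h1, h6⟩⟩

lemma exists_mem_reducedSet_of_hermite {N : ℤ} (hN : 0 < N) (hN4 : N % 4 = 1) {d e : ℤ}
    (hde : d * e = N) (b : ℤ) :
    ∃ v ∈ reducedSet N, ∃ γ : Matrix (Fin 2) (Fin 2) ℤ, γ.det = 1 ∧
      coordMatrix v.1 v.2.1 v.2.2.1 v.2.2.2 = !![e, b; 0, d] * γ := by
  have hd : d % 4 = e % 4 ∧ d % 2 = 1 := by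
    have h1 : (d % 4) * (e % 4) % 4 = 1 := by rw [← Int.mul_emod, hde, hN4]
    have h2 : d % 4 = 0 ∨ d % 4 = 1 ∨ d % 4 = 2 ∨ d % 4 = 3 := by omega
    have h3 : e % 4 = 0 ∨ e % 4 = 1 ∨ e % 4 = 2 ∨ e % 4 = 3 := by omega
    rcases h2 with h2 | h2 | h2 | h2 <;> rcases h3 with h3 | h3 | h3 | h3 <;>
      rw [h2, h3] at h1 <;> omega
  obtain ⟨h, hh⟩ : ∃ h, d = e + 4 * h := ⟨(d - e) / 4, by omega⟩
  obtain ⟨f, hf⟩ : ∃ f, e = 2 * f + 1 := ⟨e / 2, by omega⟩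
  have hs : IsState N (-2 * b * f * (f + 1)) (e + 2 * h) (-2 * b * f * (f + 1)) (2 * h) := by
    refine ⟨⟨-b * f * (f + 1) + f + h, by rw [hf]; ring⟩, ⟨_, rfl⟩,
      ⟨-b * f * (f + 1) + h, by ring⟩, .inl ⟨⟨-b * f * (f + 1), by ring⟩, ?_⟩⟩
    rw [← hde, hh]; ring
  have hH : coordMatrix (-2 * b * f * (f + 1)) (e + 2 * h) (-2 * b * f * (f + 1)) (2 * h) =
      !![e, b; 0, d] * !![-b * e, -1; 1, 0] := by
    ext i j
    fin_cases i <;> fin_cases j <;> simp [coordMatrix, Matrix.mul_apply, hh, hf] <;> ring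
  obtain ⟨l, c, k', g', t', h', hs', hk', hr, hl⟩ := hs.reduces hN
  have hd' := (hs'.det_eq.resolve_right fun h => Int.not_odd_iff_even.2 hk' h.1).2
  have hA : coordMatrix k' g' t' h' =
      !![e, b; 0, d] * ((c : ℤ) • (!![-b * e, -1; 1, 0] * (l.map wall).prod)) := by
    rw [mul_smul_comm, ← mul_assoc, ← hH, hl, smul_smul, Int.units_sq_coe, one_smul]
  refine ⟨(k', g', t', h'), ⟨hk', ?_, ?_, ?_, hr, hd'⟩, _, ?_, hA⟩
  · exact (Int.odd_add'.1 hs'.odd_g).2 hk'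
  · exact (Int.even_add.1 hs'.even_t).1 hk'
  · exact (Int.even_add.1 hs'.even_h).1 hk'
  · have := congrArg Matrix.det hA
    rw [det_coordMatrix, hd', Matrix.det_mul, Matrix.det_fin_two_of, mul_zero, sub_zero,
      mul_comm e, hde] at this
    exact (mul_eq_left₀ hN.ne').1 this.symm

lemma hermite_unique {d e b d' e' b' : ℤ} (hd : 0 < d) (hd' : 0 < d') (he : 0 < e)
    (hb : 0 ≤ b) (hbe : b < e) (hb' : 0 ≤ b') (hbe' : b' < e')
    {γ : Matrix (Fin 2) (Fin 2) ℤ} (hγ : γ.det = 1)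
    (H : !![e', b'; 0, d'] = !![e, b; 0, d] * γ) : d' = d ∧ e' = e ∧ b' = b := by
  obtain ⟨p, q, r, s, rfl⟩ : ∃ p q r s, γ = !![p, q; r, s] := ⟨_, _, _, _, Matrix.eta_fin_two γ⟩
  rw [Matrix.det_fin_two_of] at hγ
  have h00 := congrFun (congrFun H 0) 0
  have h01 := congrFun (congrFun H 0) 1
  have h10 := congrFun (congrFun H 1) 0
  have h11 := congrFun (congrFun H 1) 1
  simp [Matrix.mul_apply] at h00 h01 h10 h11
  obtain rfl : r = 0 := by omega
  have hs : 0 < s := pos_of_mul_pos_right (h11 ▸ hd') hd.le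
  have hs1 : s = 1 := Int.eq_one_of_mul_eq_one_left hs.le (by linarith)
  subst hs1
  obtain rfl : p = 1 := by linarith
  obtain rfl : e' = e := by linarith
  obtain rfl : q = 0 := by
    have h1 : q < 1 := by by_contra! h; nlinarith
    have h2 : -1 < q := by by_contra! h; nlinarith
    omega
  exact ⟨by linarith, rfl, by linarith⟩

lemma exists_hermite {x u v y N : ℤ} (hN : 0 < N) (hdet : x * y - u * v = N) :
    ∃ d e b : ℤ, 0 < d ∧ 0 < e ∧ d * e = N ∧ 0 ≤ b ∧ b < e ∧
      ∃ γ : Matrix (Fin 2) (Fin 2) ℤ, γ.det = 1 ∧ !![x, u; v, y] = !![e, b; 0, d] * γ := by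
  obtain ⟨d, hd, ⟨v', hv⟩, ⟨y', hy⟩, α, β, hbez⟩ :
      ∃ d : ℤ, 0 < d ∧ d ∣ v ∧ d ∣ y ∧ ∃ α β, d = v * α + y * β := by
    refine ⟨Int.gcd v y, ?_, Int.gcd_dvd_left v y, Int.gcd_dvd_right v y, _, _,
      Int.gcd_eq_gcd_ab v y⟩
    rcases (Int.natCast_nonneg (Int.gcd v y)).lt_or_eq with h | h
    · exact h
    · have := Int.gcd_eq_zero_iff.1 (by exact_mod_cast h.symm)
      rw [this.1, this.2] at hdet
      omega
  have h1 : v' * α + y' * β = 1 := by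
    have : d * (v' * α + y' * β) = d * 1 := by linear_combination -hbez - α * hv - β * hy
    exact mul_left_cancel₀ hd.ne' this
  set e := x * y' - u * v'
  have hde : d * e = N := by simp only [e]; linear_combination hdet - x * hy + u * hv
  have he : 0 < e := pos_of_mul_pos_right (hde ▸ hN) hd.le
  refine ⟨d, e, (x * α + u * β) % e, hd, he, hde, Int.emod_nonneg _ he.ne', Int.emod_lt_of_pos _ he,
    !![1, (x * α + u * β) / e; 0, 1] * !![β, -α; v', y'], ?_, ?_⟩
  · rw [Matrix.det_mul, Matrix.det_fin_two_of, Matrix.det_fin_two_of]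
    linear_combination h1
  · have h2 := Int.emod_add_mul_ediv (x * α + u * β) e
    rw [← mul_assoc]
    have h3 : !![e, (x * α + u * β) % e; 0, d] * !![1, (x * α + u * β) / e; 0, 1] =
        !![e, x * α + u * β; 0, d] := by
      ext i j
      fin_cases i <;> fin_cases j <;> simp [Matrix.mul_apply] ; linarith
    rw [h3]
    ext i j
    fin_cases i <;> fin_cases j <;> simp [Matrix.mul_apply]
    · simp only [e]; linear_combination -x * h1
    · simp only [e]; linear_combination -u * h1
    · exact hv
    · exact hy

theorem ncard_reducedSet {N : ℕ} (hN4 : N % 4 = 1) :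
    (reducedSet N).ncard = ∑ d ∈ N.divisors, d := by
  have hN : 0 < N := by omega
  have hN' : 0 < (N : ℤ) := by omega
  let T : Finset (Σ _ : ℕ × ℕ, ℕ) := N.divisorsAntidiagonal.sigma fun x => Finset.range x.2
  have hT : T.card = ∑ d ∈ N.divisors, d := by
    rw [Finset.card_sigma]
    simp only [Finset.card_range]
    exact Nat.sum_divisorsAntidiagonal' fun _ x => x
  rw [← hT, ← Set.ncard_coe_finset]
  have key (x : Σ _ : ℕ × ℕ, ℕ) (hx : x ∈ (T : Set _)) :
      ∃ v ∈ reducedSet N, ∃ γ : Matrix (Fin 2) (Fin 2) ℤ, γ.det = 1 ∧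
        coordMatrix v.1 v.2.1 v.2.2.1 v.2.2.2 = !![(x.1.2 : ℤ), x.2; 0, x.1.1] * γ := by
    refine exists_mem_reducedSet_of_hermite hN' (by omega) ?_ _
    simp only [T, Finset.coe_sigma, Set.mem_sigma_iff, Finset.mem_coe,
      Nat.mem_divisorsAntidiagonal] at hx
    exact_mod_cast hx.1.1
  have hdiv (x : Σ _ : ℕ × ℕ, ℕ) : x ∈ (T : Set _) ↔ x.1.1 * x.1.2 = N ∧ x.2 < x.1.2 := by
    simp [T, hN.ne']
  choose f hf γ hγ hfγ using key
  symm
  refine Set.ncard_congr f hf ?_ ?_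
  · rintro ⟨⟨d, e⟩, b⟩ ⟨⟨d', e'⟩, b'⟩ hx hx' hff
    have h1 := hfγ _ hx
    have h2 := hfγ _ hx'
    have hm := (hdiv _).1 hx
    have hm' := (hdiv _).1 hx'
    rw [← hff, h1] at h2
    have hadj : γ _ hx' * (γ _ hx').adjugate = 1 := by rw [mul_adjugate, hγ, one_smul]
    replace h2 := congrArg (fun M => M * (γ _ hx').adjugate) h2
    simp only [mul_assoc, hadj, mul_one] at h2 hm hm'
    obtain ⟨h3, h4, h5⟩ := hermite_unique (by exact_mod_cast Nat.pos_of_mul_pos_right (hm.1 ▸ hN))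
      (by exact_mod_cast Nat.pos_of_mul_pos_right (hm'.1 ▸ hN)) (by omega) (by omega) (by omega)
      (by omega) (by omega)
      (by rw [Matrix.det_mul, Matrix.det_adjugate, hγ, hγ]; simp) h2.symm
    norm_cast at h3 h4 h5
    rw [h3, h4, h5]
  · rintro ⟨k, g, t, h⟩ hv
    obtain ⟨d, e, b, hd, he, hde, hb, hbe, γ₁, hγ₁, H⟩ := exists_hermite (x := k + t) (u := h - g)
      (v := g + h) (y := k - t) hN' (by linear_combination hv.2.2.2.2.2)
    lift d to ℕ using hd.le
    lift e to ℕ using he.le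
    lift b to ℕ using hb
    have hx : (⟨(d, e), b⟩ : Σ _ : ℕ × ℕ, ℕ) ∈ (T : Set _) :=
      (hdiv _).2 ⟨by exact_mod_cast hde, by exact_mod_cast hbe⟩
    refine ⟨_, hx, ?_⟩
    have h1 := hfγ _ hx
    have hv' := hf _ hx
    have hadj : γ₁ * γ₁.adjugate = 1 := by rw [mul_adjugate, hγ₁, one_smul]
    have h2 := eq_of_reduced_of_mul (γ := γ₁.adjugate * γ _ hx) hN' (isState_of_mem_reducedSet hv)
      hv.1 (isState_of_mem_reducedSet hv') hv'.1 hv.2.2.2.2.1 hv'.2.2.2.2.1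
      (by rw [Matrix.det_mul, Matrix.det_adjugate, hγ, hγ₁]; simp)
      (by rw [h1, coordMatrix, H, mul_assoc, ← mul_assoc γ₁, hadj, one_mul])
    exact Prod.ext h2.1 (Prod.ext h2.2.1 (Prod.ext h2.2.2.1 h2.2.2.2))

end

section

open ZMod

/-- Representations of `u` as a sum of two squares the first of which is odd. -/
def twoSquares (u : ℕ) : Set (ℤ × ℤ) := {z | Odd z.1 ∧ z.1 ^ 2 + z.2 ^ 2 = u}

lemma finite_twoSquares (u : ℕ) : (twoSquares u).Finite := by
  refine ((Set.finite_Icc (-(u : ℤ)) u).prod (Set.finite_Icc (-(u : ℤ)) u)).subset ?_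
  rintro ⟨a, b⟩ ⟨-, h⟩
  simp only at h
  simp only [Set.mem_prod, Set.mem_Icc]
  refine ⟨⟨?_, ?_⟩, ?_, ?_⟩ <;> nlinarith [sq_nonneg a, sq_nonneg b]

lemma twoSquares_one : (twoSquares 1).ncard = 2 := by
  have : twoSquares 1 = {(1, 0), (-1, 0)} := by
    ext ⟨a, b⟩
    simp only [twoSquares, Set.mem_ofPred_eq, Set.mem_insert_iff, Set.mem_singleton_iff,
      Prod.mk.injEq, Nat.cast_one]
    constructor
    · rintro ⟨h, h'⟩
      have : b = 0 := by
        have : 0 < a ^ 2 := by have : a ≠ 0 := by rintro rfl; simp at h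
                               positivity
        exact pow_eq_zero_iff (two_ne_zero) |>.1 (by nlinarith [sq_nonneg b])
      subst this
      have : a ^ 2 = 1 := by simpa using h'
      rcases eq_or_eq_neg_of_sq_eq_sq a 1 (by simpa using this) with h | h <;> simp [h]
    · rintro (⟨rfl, rfl⟩ | ⟨rfl, rfl⟩) <;> simp
  rw [this, Set.ncard_pair (by simp)]

lemma ncard_twoSquares_dvd {p : ℕ} (hp : 0 < p) {α β : ℤ} (h : α ^ 2 + β ^ 2 = p) (hα : Odd α)
    (hβ : Even β) (hpα : IsCoprime (p : ℤ) α) (u : ℕ) (hu : Odd u) :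
    {z ∈ twoSquares (p * u) | (p : ℤ) ∣ α * z.1 + β * z.2}.ncard = (twoSquares u).ncard := by
  have hp' : (p : ℤ) ≠ 0 := by positivity
  symm
  refine Set.ncard_congr (fun z _ => (α * z.1 - β * z.2, α * z.2 + β * z.1)) ?_ ?_ ?_
  · rintro ⟨x, y⟩ ⟨hx, hxy⟩
    simp only at hxy hx
    refine ⟨⟨(hα.mul hx).sub_even (hβ.mul_right _), ?_⟩, ⟨x, ?_⟩⟩
    · push_cast
      rw [← h, ← hxy]; ring
    · rw [← h]; ring
  · rintro ⟨x, y⟩ ⟨x', y'⟩ - - H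
    simp only [Prod.mk.injEq] at H
    ext
    · refine mul_left_cancel₀ hp' ?_
      simp only [← h]; linear_combination α * H.1 + β * H.2
    · refine mul_left_cancel₀ hp' ?_
      simp only [← h]; linear_combination α * H.2 - β * H.1
  · rintro ⟨a, b⟩ ⟨⟨ha, hab⟩, x, hx⟩
    simp only at ha hab hx
    push_cast at hab
    obtain ⟨y, hy⟩ : (p : ℤ) ∣ α * b - β * a := by
      refine hpα.dvd_of_dvd_mul_left (y := α) ?_
      exact ⟨b - β * x, by linear_combination b * h - β * hx⟩
    have hb : Even b := by
      have : Odd (a ^ 2 + b ^ 2) := by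
        rw [hab, ← h]
        exact ((hα.pow).add_even (hβ.pow_of_ne_zero two_ne_zero)).mul (by exact_mod_cast hu)
      rw [Int.odd_add] at this
      simpa [Int.even_pow] using this.1 ha.pow
    refine ⟨(x, y), ⟨?_, ?_⟩, ?_⟩
    · have : Odd ((p : ℤ) * x) := by rw [← hx]; exact (hα.mul ha).add_even (hβ.mul_right _)
      exact (Int.odd_mul.1 this).2
    · have : (p : ℤ) ^ 2 * (x ^ 2 + y ^ 2) = (p : ℤ) ^ 2 * u := by
        linear_combination -(α * a + β * b + p * x) * hx - (α * b - β * a + p * y) * hy +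
          (a ^ 2 + b ^ 2) * h + p * hab
      exact mul_left_cancel₀ (pow_ne_zero 2 hp') this
    · simp only [Prod.mk.injEq]
      constructor <;> refine mul_left_cancel₀ hp' ?_
      · linear_combination - α * hx + β * hy + a * h
      · linear_combination - α * hy - β * hx + b * h

/-- Representations of `u` with both coordinates divisible by `p`. -/
def twoSquaresDvd (p u : ℕ) : Set (ℤ × ℤ) :=
  {z ∈ twoSquares u | (p : ℤ) ∣ z.1 ∧ (p : ℤ) ∣ z.2}

lemma ncard_twoSquaresDvd_mul_sq {p : ℕ} (hp : Odd p) (u : ℕ) :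
    (twoSquaresDvd p (p * (p * u))).ncard = (twoSquares u).ncard := by
  have hp' : (p : ℤ) ≠ 0 := by have := hp.pos; positivity
  symm
  refine Set.ncard_congr (fun z _ => (p * z.1, p * z.2)) ?_ ?_ ?_
  · rintro ⟨x, y⟩ ⟨hx, hxy⟩
    simp only at hxy hx
    refine ⟨⟨.mul (by exact_mod_cast hp) hx, ?_⟩, ⟨x, rfl⟩, ⟨y, rfl⟩⟩
    push_cast
    rw [← hxy]; ring
  · rintro ⟨x, y⟩ ⟨x', y'⟩ - - H
    simpa [hp.pos.ne'] using H
  · rintro ⟨_, _⟩ ⟨⟨ha, hab⟩, ⟨x, rfl⟩, ⟨y, rfl⟩⟩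
    refine ⟨(x, y), ⟨(Int.odd_mul.1 ha).2, ?_⟩, rfl⟩
    refine mul_left_cancel₀ (pow_ne_zero 2 hp') ?_
    push_cast at hab
    simp only at hab ⊢
    linear_combination hab

lemma twoSquaresDvd_mul {p u : ℕ} (hp : 0 < p) (hu : ¬ p ∣ u) : twoSquaresDvd p (p * u) = ∅ := by
  rw [Set.eq_empty_iff_forall_notMem]
  rintro ⟨_, _⟩ ⟨⟨-, hab⟩, ⟨x, rfl⟩, ⟨y, rfl⟩⟩
  refine hu ?_
  have hp' : (p : ℤ) ≠ 0 := by positivity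
  have : (u : ℤ) = p * (x ^ 2 + y ^ 2) := by
    refine mul_left_cancel₀ hp' ?_
    push_cast at hab
    linear_combination -hab
  exact Int.natCast_dvd_natCast.1 ⟨_, this⟩

lemma twoSquares_prime_mul_of_three {p : ℕ} (hp : p.Prime) (hp4 : p % 4 = 3) (u : ℕ) :
    twoSquares (p * u) = twoSquaresDvd p (p * u) := by
  have := Fact.mk hp
  refine Set.Subset.antisymm ?_ fun z hz => hz.1
  rintro ⟨a, b⟩ hz
  refine ⟨hz, ?_⟩
  simp only [← ZMod.intCast_zmod_eq_zero_iff_dvd, ← ZMod.intCast_zmod_eq_zero_iff_dvd]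
  have h : (a : ZMod p) ^ 2 = - (b : ZMod p) ^ 2 := by
    have := congrArg (Int.cast : ℤ → ZMod p) hz.2
    push_cast at this
    rw [CharP.cast_eq_zero, zero_mul] at this
    exact eq_neg_of_add_eq_zero_left this
  have hb : (b : ZMod p) = 0 := by
    by_contra hb
    exact ZMod.mod_four_ne_three_of_sq_eq_neg_sq' hb h hp4
  rw [hb] at h
  exact ⟨by simpa using h, hb⟩

lemma ncard_twoSquares_prime_mul_of_one {p : ℕ} (hp : p.Prime) (hp4 : p % 4 = 1) {u : ℕ}
    (hu : Odd u) :
    (twoSquares (p * u)).ncard + (twoSquaresDvd p (p * u)).ncard = 2 * (twoSquares u).ncard := by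
  have := Fact.mk hp
  obtain ⟨α, β, h, hα, hβ⟩ : ∃ α β : ℤ, α ^ 2 + β ^ 2 = p ∧ Odd α ∧ Even β := by
    obtain ⟨a, b, h⟩ := Nat.Prime.sq_add_sq (p := p) (by omega)
    have ho : Odd (a ^ 2 + b ^ 2) := by rw [h, Nat.odd_iff]; omega
    rcases Nat.even_or_odd a with ha | ha
    · have hb : Odd b := by
        by_contra hb
        rw [Nat.not_odd_iff_even] at hb
        exact Nat.not_even_iff_odd.2 ho
          ((ha.pow_of_ne_zero two_ne_zero).add (hb.pow_of_ne_zero two_ne_zero))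
      exact ⟨b, a, by rw [add_comm]; exact_mod_cast h, by exact_mod_cast hb, by exact_mod_cast ha⟩
    · have hb : Even b := by
        by_contra hb
        rw [Nat.not_even_iff_odd] at hb
        exact Nat.not_even_iff_odd.2 ho (ha.pow.add_odd hb.pow)
      exact ⟨a, b, by exact_mod_cast h, by exact_mod_cast ha, by exact_mod_cast hb⟩
  have hpZ : Prime (p : ℤ) := Nat.prime_iff_prime_int.1 hp
  have hnd : ∀ {x y : ℤ}, x ^ 2 + y ^ 2 = p → ¬ (p : ℤ) ∣ x := by
    rintro x y hxy ⟨c, rfl⟩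
    have h1 : (p : ℤ) ∣ y := hpZ.dvd_of_dvd_pow (n := 2) ⟨1 - p * c ^ 2, by linear_combination hxy⟩
    obtain ⟨d, rfl⟩ := h1
    have h2 : (p : ℤ) * (c ^ 2 + d ^ 2) = 1 :=
      mul_left_cancel₀ hpZ.ne_zero (by linear_combination hxy)
    exact hpZ.not_isUnit (IsUnit.of_mul_eq_one _ h2)
  have hcα : IsCoprime (p : ℤ) α := (Prime.coprime_iff_not_dvd hpZ).2 (hnd h)
  have hcβ : IsCoprime (p : ℤ) β := (Prime.coprime_iff_not_dvd hpZ).2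
    (hnd (by rw [add_comm]; exact h))
  have hc2 : IsCoprime (p : ℤ) 2 := (Prime.coprime_iff_not_dvd hpZ).2 (by
    intro h
    have := Nat.le_of_dvd two_pos (by exact_mod_cast h)
    have := hp.one_lt
    omega)
  have h1 := ncard_twoSquares_dvd hp.pos h hα hβ hcα u hu
  have h2 := ncard_twoSquares_dvd hp.pos (β := -β) (by rw [neg_sq]; exact h) hα hβ.neg hcα u hu
  rw [two_mul]
  nth_rw 1 [← h1]
  rw [← h2, ← Set.ncard_union_add_ncard_inter _ _
    ((finite_twoSquares _).subset (Set.sep_subset _ _))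
    ((finite_twoSquares _).subset (Set.sep_subset _ _))]
  congr 2
  · refine Set.Subset.antisymm ?_ (Set.union_subset (Set.sep_subset _ _) (Set.sep_subset _ _))
    rintro ⟨a, b⟩ hz
    have : (p : ℤ) ∣ (α * a + β * b) * (α * a + -β * b) := by
      have := hz.2
      push_cast at this
      exact ⟨α ^ 2 * u - b ^ 2, by linear_combination α ^ 2 * this - b ^ 2 * h⟩
    exact (hpZ.dvd_or_dvd this).imp (⟨hz, ·⟩) (⟨hz, ·⟩)
  · ext ⟨a, b⟩
    constructor
    · rintro ⟨hz, ha, hb⟩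
      exact ⟨⟨hz, dvd_add (ha.mul_left _) (hb.mul_left _)⟩,
        ⟨hz, dvd_add (ha.mul_left _) (hb.mul_left _)⟩⟩
    · rintro ⟨⟨hz, ha⟩, -, hb⟩
      refine ⟨hz, hcα.dvd_of_dvd_mul_left (hc2.dvd_of_dvd_mul_left ?_),
        hcβ.dvd_of_dvd_mul_left (hc2.dvd_of_dvd_mul_left ?_)⟩
      · convert dvd_add ha hb using 1; simp only; ring
      · convert dvd_sub ha hb using 1; simp only; ring

lemma ncard_twoSquares_prime_pow_mul {p : ℕ} (hp : p.Prime) (hp2 : p ≠ 2) {u : ℕ} (hu : Odd u)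
    (hpu : ¬ p ∣ u) (k : ℕ) :
    ((twoSquares (p ^ k * u)).ncard : ℤ) =
      (∑ i ∈ Finset.range (k + 1), χ₄ p ^ i) * (twoSquares u).ncard := by
  have hpo : Odd p := hp.odd_of_ne_two hp2
  induction k using Nat.twoStepInduction with
  | zero => simp
  | one =>
    have h0 : (twoSquaresDvd p (p * u)).ncard = 0 := by rw [twoSquaresDvd_mul hp.pos hpu]; simp
    rw [pow_one]
    rcases Nat.odd_mod_four_iff.1 (Nat.odd_iff.1 hpo) with h | h
    · have := ncard_twoSquares_prime_mul_of_one hp h hu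
      rw [χ₄_nat_one_mod_four h]
      simp only [Finset.sum_range_succ]
      simp; omega
    · rw [twoSquares_prime_mul_of_three hp h, h0, χ₄_nat_three_mod_four h]
      simp [Finset.sum_range_succ]
  | more k ih1 ih2 =>
    have h0 := ncard_twoSquaresDvd_mul_sq hpo (p ^ k * u)
    have e1 : p ^ (k + 2) * u = p * (p ^ (k + 1) * u) := by ring
    have e2 : p * (p ^ (k + 1) * u) = p * (p * (p ^ k * u)) := by ring
    rw [e1]
    rcases Nat.odd_mod_four_iff.1 (Nat.odd_iff.1 hpo) with h | h
    · have := ncard_twoSquares_prime_mul_of_one hp h (hpo.pow.mul hu : Odd (p ^ (k + 1) * u))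
      rw [e2, h0, ← e2] at this
      rw [χ₄_nat_one_mod_four h] at ih1 ih2 ⊢
      simp at ih1 ih2 ⊢
      zify at this
      rw [ih1, ih2] at this
      linear_combination this
    · rw [twoSquares_prime_mul_of_three hp h, e2, h0, ih1]
      simp only [Finset.sum_range_succ _ (k + 2), Finset.sum_range_succ _ (k + 1),
        χ₄_nat_three_mod_four h]
      ring

lemma sum_divisors_χ₄_prime_pow_mul {p : ℕ} (hp : p.Prime) {u : ℕ} (hpu : ¬ p ∣ u) (k : ℕ) :
    ∑ d ∈ (p ^ k * u).divisors, χ₄ d =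
      (∑ i ∈ Finset.range (k + 1), χ₄ p ^ i) * ∑ d ∈ u.divisors, χ₄ d := by
  let f : ArithmeticFunction ℤ := ⟨fun n => χ₄ n, by simp⟩
  have hf : f.IsMultiplicative := ⟨by simp [f], fun {m n} _ => by
    simp only [f, ArithmeticFunction.coe_mk, Nat.cast_mul, map_mul]⟩
  have hm := hf.mul ArithmeticFunction.isMultiplicative_zeta.natCast
  have key (n : ℕ) : (f * ArithmeticFunction.zeta) n = ∑ d ∈ n.divisors, χ₄ d :=
    ArithmeticFunction.coe_mul_zeta_apply
  rw [← key, hm.map_mul_of_coprime, key, key, Nat.sum_divisors_prime_pow hp]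
  · simp only [Nat.cast_pow, map_pow]
  · exact (Nat.Prime.coprime_iff_not_dvd hp).2 hpu |>.pow_left k

theorem ncard_twoSquares {u : ℕ} (hu : Odd u) :
    ((twoSquares u).ncard : ℤ) = 2 * ∑ d ∈ u.divisors, χ₄ d := by
  induction u using Nat.strong_induction_on with
  | _ u ih =>
    by_cases h1 : u = 1
    · subst h1
      simp [twoSquares_one]
    have hp := Nat.minFac_prime h1
    have hp2 : u.minFac ≠ 2 := fun h => Nat.not_even_iff_odd.2 hu (even_iff_two_dvd.2
      (h ▸ Nat.minFac_dvd u))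
    obtain ⟨k, m, hm, hk⟩ := Nat.exists_eq_pow_mul_and_not_dvd hu.pos.ne' _ hp.ne_one
    have hmo : Odd m := by rw [hk] at hu; exact (Nat.odd_mul.1 hu).2
    have hlt : m < u := by
      refine lt_of_le_of_ne (Nat.le_of_dvd hu.pos ⟨_, by rw [mul_comm]; exact hk⟩) ?_
      rintro rfl
      exact hm (Nat.minFac_dvd m)
    rw [hk, ncard_twoSquares_prime_pow_mul hp hp2 hmo hm, sum_divisors_χ₄_prime_pow_mul hp hm,
      ih m hlt hmo]
    ring

end

section

open ZMod

/-- Quadruples `(a, b, c, d)` of odd natural numbers with `a b + c d = 2 N`. -/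
def oddQuads (N : ℕ) : Finset (ℕ × ℕ × ℕ × ℕ) :=
  (Finset.range (2 * N + 1) ×ˢ Finset.range (2 * N + 1) ×ˢ Finset.range (2 * N + 1) ×ˢ
    Finset.range (2 * N + 1)).filter fun x =>
      Odd x.1 ∧ Odd x.2.1 ∧ Odd x.2.2.1 ∧ Odd x.2.2.2 ∧ x.1 * x.2.1 + x.2.2.1 * x.2.2.2 = 2 * N

lemma mem_oddQuads {N a b c d : ℕ} : (a, b, c, d) ∈ oddQuads N ↔
    Odd a ∧ Odd b ∧ Odd c ∧ Odd d ∧ a * b + c * d = 2 * N := by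
  simp only [oddQuads, Finset.mem_filter, Finset.mem_product, Finset.mem_range,
    and_iff_right_iff_imp]
  rintro ⟨ha, hb, hc, hd, h⟩
  have := Nat.le_mul_of_pos_right a hb.pos
  have := Nat.le_mul_of_pos_left b ha.pos
  have := Nat.le_mul_of_pos_right c hd.pos
  have := Nat.le_mul_of_pos_left d hc.pos
  omega

/-- Quadruples `(c, s, e, b)` with `c, b` odd, `0 < e`, `b < 2 s` and `c s + e b = N`. -/
def shiftedQuads (N : ℕ) : Finset (ℕ × ℕ × ℕ × ℕ) :=
  (Finset.range (N + 1) ×ˢ Finset.range (N + 1) ×ˢ Finset.range (N + 1) ×ˢ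
    Finset.range (N + 1)).filter fun x =>
      Odd x.1 ∧ Odd x.2.2.2 ∧ 0 < x.2.2.1 ∧ x.2.2.2 < 2 * x.2.1 ∧
        x.1 * x.2.1 + x.2.2.1 * x.2.2.2 = N

lemma mem_shiftedQuads {N c s e b : ℕ} : (c, s, e, b) ∈ shiftedQuads N ↔
    Odd c ∧ Odd b ∧ 0 < e ∧ b < 2 * s ∧ c * s + e * b = N := by
  simp only [shiftedQuads, Finset.mem_filter, Finset.mem_product, Finset.mem_range,
    and_iff_right_iff_imp]
  rintro ⟨hc, hb, he, hbs, h⟩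
  have := Nat.le_mul_of_pos_right c (show 0 < s by omega)
  have := Nat.le_mul_of_pos_left s hc.pos
  have := Nat.le_mul_of_pos_right e hb.pos
  have := Nat.le_mul_of_pos_left b he
  omega

lemma χ₄_mul_self_of_odd {a : ℕ} (ha : Odd a) : χ₄ a * χ₄ a = 1 := by
  rcases Nat.odd_mod_four_iff.1 (Nat.odd_iff.1 ha) with h | h
  · rw [χ₄_nat_one_mod_four h, one_mul]
  · rw [χ₄_nat_three_mod_four h]; rfl

lemma χ₄_add_two_mul {c : ℕ} (hc : Odd c) (e : ℕ) :
    χ₄ ((c + 2 * e : ℕ)) * χ₄ c = (-1) ^ e := by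
  rw [Nat.odd_iff] at hc
  rcases Nat.even_or_odd e with he | he
  · rw [he.neg_one_pow]
    rw [Nat.even_iff] at he
    rw [χ₄_nat_eq_if_mod_four, χ₄_nat_eq_if_mod_four]
    split_ifs <;> omega
  · rw [he.neg_one_pow]
    rw [Nat.odd_iff] at he
    rw [χ₄_nat_eq_if_mod_four, χ₄_nat_eq_if_mod_four]
    split_ifs <;> omega

lemma shift_involution {c s e b : ℕ} (hbs : b < 2 * s) :
    (b + 2 * s * (c / (2 * e))) / (2 * s) = c / (2 * e) ∧
    (b + 2 * s * (c / (2 * e))) % (2 * s) = b ∧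
    c % (2 * e) + 2 * e * (c / (2 * e)) = c := by
  refine ⟨?_, ?_, Nat.mod_add_div _ _⟩
  · rw [Nat.add_mul_div_left _ _ (by omega), Nat.div_eq_of_lt hbs, zero_add]
  · rw [Nat.add_mul_mod_self_left, Nat.mod_eq_of_lt hbs]

lemma sum_shiftedQuads {N : ℕ} (hN : Odd N) :
    ∑ x ∈ shiftedQuads N, (-1 : ℤ) ^ x.2.2.1 = 0 := by
  have hinv : ∀ x ∈ shiftedQuads N, (x.2.2.2 + 2 * x.2.1 * (x.1 / (2 * x.2.2.1)), x.2.2.1, x.2.1,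
      x.1 % (2 * x.2.2.1)) ∈ shiftedQuads N := by
    rintro ⟨c, s, e, b⟩ hx
    rw [mem_shiftedQuads] at hx ⊢
    obtain ⟨hc, hb, he, hbs, h⟩ := hx
    refine ⟨hb.add_even ((even_two.mul_right _).mul_right _), ?_, by simp only; omega,
      Nat.mod_lt _ (by simp only; omega), ?_⟩
    · have := Nat.mod_add_div c (2 * e)
      rw [← this, mul_assoc] at hc
      exact (Nat.odd_add.1 hc).2 (even_two_mul _)
    · have := Nat.mod_add_div c (2 * e)
      simp only
      rw [← h]
      nth_rw 3 [← this]
      ring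
  have hpar : ∀ {c s e b : ℕ}, (c, s, e, b) ∈ shiftedQuads N → (-1 : ℤ) ^ e + (-1) ^ s = 0 := by
    intro c s e b hx
    rw [mem_shiftedQuads] at hx
    obtain ⟨hc, hb, -, -, h⟩ := hx
    rw [← h] at hN
    rcases Nat.even_or_odd s with hs | hs
    · have : Odd e := (Nat.odd_mul.1 ((Nat.odd_add'.1 hN).2 (hs.mul_left _))).1
      rw [hs.neg_one_pow, this.neg_one_pow]; rfl
    · have : Even (e * b) := (Nat.odd_add.1 hN).1 (hc.mul hs)
      have : Even e := (Nat.even_mul.1 this).resolve_right (Nat.not_even_iff_odd.2 hb)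
      rw [hs.neg_one_pow, this.neg_one_pow]; rfl
  refine Finset.sum_involution (fun x _ => (x.2.2.2 + 2 * x.2.1 * (x.1 / (2 * x.2.2.1)), x.2.2.1,
    x.2.1, x.1 % (2 * x.2.2.1))) ?_ ?_ hinv ?_
  · rintro ⟨c, s, e, b⟩ hx
    exact hpar hx
  · rintro ⟨c, s, e, b⟩ hx - H
    simp only [Prod.mk.injEq] at H
    have := hpar hx
    rw [H.2.1] at this
    rcases neg_one_pow_eq_or ℤ s with h | h <;> rw [h] at this <;> omega
  · rintro ⟨c, s, e, b⟩ hx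
    rw [mem_shiftedQuads] at hx
    obtain ⟨h1, h2, h3⟩ := shift_involution (c := c) (e := e) hx.2.2.2.1
    simp only [h1, h2, h3]

lemma sum_oddQuads_lt {N : ℕ} (hN : Odd N) :
    ∑ x ∈ oddQuads N with x.2.2.1 < x.1, χ₄ x.1 * χ₄ x.2.2.1 = 0 := by
  rw [← sum_shiftedQuads hN]
  refine Finset.sum_bij' (fun x _ => (x.2.2.1, (x.2.1 + x.2.2.2) / 2, (x.1 - x.2.2.1) / 2, x.2.1))
    (fun x _ => (x.1 + 2 * x.2.2.1, x.2.2.2, x.1, 2 * x.2.1 - x.2.2.2)) ?_ ?_ ?_ ?_ ?_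
  · rintro ⟨a, b, c, d⟩ hx
    rw [Finset.mem_filter, mem_oddQuads] at hx
    obtain ⟨⟨⟨a, rfl⟩, ⟨b, rfl⟩, ⟨c, rfl⟩, ⟨d, rfl⟩, h⟩, hlt⟩ := hx
    simp only at hlt ⊢
    obtain ⟨e, rfl⟩ : ∃ e, a = c + e := ⟨a - c, by omega⟩
    have h1 : (2 * b + 1 + (2 * d + 1)) / 2 = b + d + 1 := by omega
    have h2 : (2 * (c + e) + 1 - (2 * c + 1)) / 2 = e := by omega
    rw [mem_shiftedQuads, h1, h2]
    refine ⟨⟨c, rfl⟩, ⟨b, rfl⟩, by omega, by omega, by nlinarith⟩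
  · rintro ⟨c, s, e, b⟩ hx
    rw [mem_shiftedQuads] at hx
    obtain ⟨⟨c, rfl⟩, ⟨b, rfl⟩, he, hbs, h⟩ := hx
    obtain ⟨d, rfl⟩ : ∃ d, s = b + d + 1 := ⟨s - b - 1, by omega⟩
    have h1 : 2 * (b + d + 1) - (2 * b + 1) = 2 * d + 1 := by omega
    rw [Finset.mem_filter, mem_oddQuads]
    simp only [h1]
    refine ⟨⟨⟨c + e, by ring⟩, ⟨b, rfl⟩, ⟨c, rfl⟩, ⟨d, rfl⟩, by nlinarith⟩, by omega⟩
  · rintro ⟨a, b, c, d⟩ hx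
    rw [Finset.mem_filter, mem_oddQuads] at hx
    obtain ⟨⟨⟨a, rfl⟩, ⟨b, rfl⟩, ⟨c, rfl⟩, ⟨d, rfl⟩, h⟩, hlt⟩ := hx
    simp only [Prod.mk.injEq, true_and] at hlt ⊢
    omega
  · rintro ⟨c, s, e, b⟩ hx
    rw [mem_shiftedQuads] at hx
    simp only [Prod.mk.injEq, true_and, and_true]
    constructor <;> omega
  · rintro ⟨a, b, c, d⟩ hx
    rw [Finset.mem_filter, mem_oddQuads] at hx
    obtain ⟨⟨⟨a, rfl⟩, ⟨b, rfl⟩, ⟨c, rfl⟩, ⟨d, rfl⟩, h⟩, hlt⟩ := hx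
    simp only at hlt ⊢
    rw [← χ₄_add_two_mul ⟨c, rfl⟩]
    congr 3
    omega

lemma sum_oddQuads_eq {N : ℕ} (hN : Odd N) :
    ∑ x ∈ oddQuads N with x.1 = x.2.2.1, χ₄ x.1 * χ₄ x.2.2.1 = ((∑ d ∈ N.divisors, d : ℕ) : ℤ) := by
  rw [← Nat.sum_divisorsAntidiagonal' fun _ x => x]
  have h1 (x : ℕ × ℕ) : x.2 = ∑ i ∈ Finset.range x.2, 1 := by simp
  rw [Finset.sum_congr rfl fun x _ => h1 x, Finset.sum_sigma', Nat.cast_sum]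
  refine Finset.sum_bij' (fun x _ => ⟨(x.1, (x.2.1 + x.2.2.2) / 2), x.2.1 / 2⟩)
    (fun x _ => (x.1.1, 2 * x.2 + 1, x.1.1, 2 * x.1.2 - (2 * x.2 + 1))) ?_ ?_ ?_ ?_ ?_
  · rintro ⟨a, b, c, d⟩ hx
    rw [Finset.mem_filter, mem_oddQuads] at hx
    obtain ⟨⟨ha, ⟨b, rfl⟩, hc, ⟨d, rfl⟩, h⟩, hlt⟩ := hx
    simp only at hlt
    subst hlt
    have h1 : (2 * b + 1 + (2 * d + 1)) / 2 = b + d + 1 := by omega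
    simp only [Finset.mem_sigma, Nat.mem_divisorsAntidiagonal, Finset.mem_range, h1]
    exact ⟨⟨by linarith, hN.pos.ne'⟩, by omega⟩
  · rintro ⟨⟨a, e⟩, i⟩ hx
    simp only [Finset.mem_sigma, Nat.mem_divisorsAntidiagonal, Finset.mem_range] at hx
    obtain ⟨⟨rfl, -⟩, hi⟩ := hx
    obtain ⟨d, rfl⟩ : ∃ d, e = i + d + 1 := ⟨e - i - 1, by omega⟩
    have h1 : 2 * (i + d + 1) - (2 * i + 1) = 2 * d + 1 := by omega
    have ha := (Nat.odd_mul.1 hN).1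
    rw [Finset.mem_filter, mem_oddQuads]
    simp only [h1]
    exact ⟨⟨ha, ⟨i, rfl⟩, ha, ⟨d, rfl⟩, by ring⟩, trivial⟩
  · rintro ⟨a, b, c, d⟩ hx
    rw [Finset.mem_filter, mem_oddQuads] at hx
    obtain ⟨⟨ha, ⟨b, rfl⟩, hc, ⟨d, rfl⟩, h⟩, hlt⟩ := hx
    simp only [Prod.mk.injEq, true_and] at hlt ⊢
    omega
  · rintro ⟨⟨a, e⟩, i⟩ hx
    simp only [Finset.mem_sigma, Nat.mem_divisorsAntidiagonal, Finset.mem_range] at hx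
    have h1 : (2 * i + 1 + (2 * e - (2 * i + 1))) / 2 = e := by omega
    have h2 : (2 * i + 1) / 2 = i := by omega
    simp only [h1, h2]
  · rintro ⟨a, b, c, d⟩ hx
    rw [Finset.mem_filter, mem_oddQuads] at hx
    have h2 : a = c := hx.2
    rw [← h2, χ₄_mul_self_of_odd hx.1.1, Nat.cast_one]

theorem sum_oddQuads {N : ℕ} (hN : Odd N) :
    ∑ x ∈ oddQuads N, χ₄ x.1 * χ₄ x.2.2.1 = ((∑ d ∈ N.divisors, d : ℕ) : ℤ) := by
  have hgt : ∑ x ∈ oddQuads N with x.1 < x.2.2.1, χ₄ x.1 * χ₄ x.2.2.1 = 0 := by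
    rw [← sum_oddQuads_lt hN]
    refine Finset.sum_bij' (fun x _ => (x.2.2.1, x.2.2.2, x.1, x.2.1))
      (fun x _ => (x.2.2.1, x.2.2.2, x.1, x.2.1)) ?_ ?_ (fun _ _ => rfl) (fun _ _ => rfl)
      (fun _ _ => mul_comm _ _) <;>
    · rintro ⟨a, b, c, d⟩ hx
      rw [Finset.mem_filter, mem_oddQuads] at hx ⊢
      rw [add_comm]
      tauto
  have h1 : {x ∈ oddQuads N | ¬ x.1 = x.2.2.1 ∧ x.1 < x.2.2.1} = {x ∈ oddQuads N | x.1 < x.2.2.1} :=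
    Finset.filter_congr (by intros; omega)
  have h2 : {x ∈ oddQuads N | ¬ x.1 = x.2.2.1 ∧ ¬ x.1 < x.2.2.1} =
      {x ∈ oddQuads N | x.2.2.1 < x.1} := Finset.filter_congr (by intros; omega)
  rw [← Finset.sum_filter_add_sum_filter_not _ fun x => x.1 = x.2.2.1, sum_oddQuads_eq hN,
    ← Finset.sum_filter_add_sum_filter_not {x ∈ oddQuads N | ¬ x.1 = x.2.2.1}
      fun x => x.1 < x.2.2.1,
    Finset.filter_filter, Finset.filter_filter, h1, h2, hgt, sum_oddQuads_lt hN, add_zero, add_zero]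

end

section

open ZMod

/-- Representations of `N` as a sum of four squares with only the second one odd. -/
def fourSquares (N : ℤ) : Set (ℤ × ℤ × ℤ × ℤ) :=
  {v | Even v.1 ∧ Odd v.2.1 ∧ Even v.2.2.1 ∧ Even v.2.2.2 ∧
    v.1 ^ 2 + v.2.1 ^ 2 + v.2.2.1 ^ 2 + v.2.2.2 ^ 2 = N}

lemma finite_fourSquares (N : ℤ) : (fourSquares N).Finite := by
  have hf := Set.finite_Icc (-N) N
  refine (hf.prod (hf.prod (hf.prod hf))).subset ?_
  rintro ⟨a, b, c, d⟩ ⟨-, -, -, -, h⟩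
  simp only at h
  simp only [Set.mem_prod, Set.mem_Icc]
  refine ⟨⟨?_, ?_⟩, ⟨?_, ?_⟩, ⟨?_, ?_⟩, ?_, ?_⟩ <;>
    nlinarith [sq_nonneg a, sq_nonneg b, sq_nonneg c, sq_nonneg d]

/-- The ways of writing `2 N` as an ordered sum of two odd natural numbers. -/
def oddAntidiagonal (N : ℕ) : Finset (ℕ × ℕ) :=
  {x ∈ Finset.HasAntidiagonal.antidiagonal (2 * N) | Odd x.1}

lemma mem_oddAntidiagonal {N u v : ℕ} :
    (u, v) ∈ oddAntidiagonal N ↔ Odd u ∧ Odd v ∧ u + v = 2 * N := by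
  simp only [oddAntidiagonal, Finset.mem_filter, Finset.HasAntidiagonal.mem_antidiagonal]
  constructor
  · rintro ⟨h1, h2⟩
    refine ⟨h2, ?_, h1⟩
    rw [Nat.odd_iff] at *
    omega
  · rintro ⟨h1, h2, h3⟩
    exact ⟨h3, h1⟩

lemma sum_sum_divisors_χ₄_mul {N : ℕ} (hN : Odd N) :
    ∑ x ∈ oddAntidiagonal N, (∑ d ∈ x.1.divisors, χ₄ d) * (∑ d ∈ x.2.divisors, χ₄ d) =
      ((∑ d ∈ N.divisors, d : ℕ) : ℤ) := by
  rw [← sum_oddQuads hN]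
  have h1 (u : ℕ) : ∑ d ∈ u.divisors, χ₄ d = ∑ y ∈ u.divisorsAntidiagonal, χ₄ y.1 :=
    (Nat.sum_divisorsAntidiagonal fun a _ => χ₄ a).symm
  simp only [h1, Finset.sum_mul_sum]
  simp only [← Finset.sum_product', Finset.sum_sigma']
  refine Finset.sum_bij' (fun x _ => (x.2.1.1, x.2.1.2, x.2.2.1, x.2.2.2))
    (fun x _ => ⟨(x.1 * x.2.1, x.2.2.1 * x.2.2.2), (x.1, x.2.1), x.2.2⟩) ?_ ?_ ?_ ?_ ?_
  · rintro ⟨⟨u, v⟩, ⟨a, b⟩, c, d⟩ hx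
    simp only [Finset.mem_sigma, mem_oddAntidiagonal, Finset.mem_product,
      Nat.mem_divisorsAntidiagonal] at hx
    obtain ⟨⟨hu, hv, huv⟩, ⟨rfl, -⟩, rfl, -⟩ := hx
    rw [Nat.odd_mul] at hu hv
    exact mem_oddQuads.2 ⟨hu.1, hu.2, hv.1, hv.2, huv⟩
  · rintro ⟨a, b, c, d⟩ hx
    rw [mem_oddQuads] at hx
    obtain ⟨ha, hb, hc, hd, h⟩ := hx
    simp only [Finset.mem_sigma, mem_oddAntidiagonal, Finset.mem_product,
      Nat.mem_divisorsAntidiagonal]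
    exact ⟨⟨ha.mul hb, hc.mul hd, h⟩, ⟨trivial, (ha.mul hb).pos.ne'⟩, trivial, (hc.mul hd).pos.ne'⟩
  · rintro ⟨⟨u, v⟩, ⟨a, b⟩, c, d⟩ hx
    simp only [Finset.mem_sigma, mem_oddAntidiagonal, Finset.mem_product,
      Nat.mem_divisorsAntidiagonal] at hx
    obtain ⟨-, ⟨rfl, -⟩, rfl, -⟩ := hx
    rfl
  · intros; rfl
  · intros; rfl

theorem sum_ncard_twoSquares_mul {N : ℕ} (hN : Odd N) :
    ∑ x ∈ oddAntidiagonal N, (twoSquares x.1).ncard * (twoSquares x.2).ncard =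
      4 * ∑ d ∈ N.divisors, d := by
  zify
  have := sum_sum_divisors_χ₄_mul hN
  push_cast at this
  rw [← this, Finset.mul_sum]
  refine Finset.sum_congr rfl ?_
  rintro ⟨u, v⟩ hx
  rw [mem_oddAntidiagonal] at hx
  rw [ncard_twoSquares hx.1, ncard_twoSquares hx.2.1]
  ring

lemma even_of_sq_add_sq {a b : ℤ} (ha : Odd a) (h : Odd (a ^ 2 + b ^ 2)) : Even b := by
  rw [Int.odd_add] at h
  simpa [Int.even_pow] using h.1 ha.pow

lemma ncard_fourSquares_add {N : ℕ} :
    {v : ℤ × ℤ × ℤ × ℤ | Odd (v.1 + v.2.1) ∧ Even (v.2.2.1 + v.2.2.2) ∧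
      v.1 ^ 2 + v.2.1 ^ 2 + v.2.2.1 ^ 2 + v.2.2.2 ^ 2 = N}.ncard =
    ∑ x ∈ oddAntidiagonal N, (twoSquares x.1).ncard * (twoSquares x.2).ncard := by
  let R (u : ℕ) : Finset (ℤ × ℤ) := (finite_twoSquares u).toFinset
  have hR (u : ℕ) : (twoSquares u).ncard = (R u).card :=
    Set.ncard_eq_toFinset_card _ (finite_twoSquares u)
  simp only [hR, ← Finset.card_product]
  rw [← Finset.card_sigma, ← Set.ncard_coe_finset]
  refine Set.ncard_congr (fun v _ => ⟨(((v.1 + v.2.1) ^ 2 + (v.2.2.1 + v.2.2.2) ^ 2).toNat,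
    ((v.1 - v.2.1) ^ 2 + (v.2.2.1 - v.2.2.2) ^ 2).toNat),
    (v.1 + v.2.1, v.2.2.1 + v.2.2.2), (v.1 - v.2.1, v.2.2.1 - v.2.2.2)⟩) ?_ ?_ ?_
  · rintro ⟨k, g, t, h⟩ ⟨h1, h2, h3⟩
    simp only at h1 h2 h3
    have h1' : Odd (k - g) := by rwa [Int.odd_sub, ← Int.odd_add]
    have h2' : Even (t - h) := by rwa [Int.even_sub, ← Int.even_add]
    have e1 : Odd ((k + g) ^ 2 + (t + h) ^ 2) :=
      h1.pow.add_even (h2.pow_of_ne_zero two_ne_zero)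
    have e2 : Odd ((k - g) ^ 2 + (t - h) ^ 2) :=
      h1'.pow.add_even (h2'.pow_of_ne_zero two_ne_zero)
    have hu := Int.toNat_of_nonneg (show 0 ≤ (k + g) ^ 2 + (t + h) ^ 2 by positivity)
    have hv := Int.toNat_of_nonneg (show 0 ≤ (k - g) ^ 2 + (t - h) ^ 2 by positivity)
    simp only [Finset.coe_sigma, Set.mem_sigma_iff, Finset.mem_coe, mem_oddAntidiagonal,
      Finset.mem_product, R, Set.Finite.mem_toFinset]
    rw [← hu] at e1
    rw [← hv] at e2
    refine ⟨⟨by exact_mod_cast e1, by exact_mod_cast e2, ?_⟩, ⟨h1, hu.symm⟩, h1', hv.symm⟩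
    zify
    rw [hu, hv]
    linear_combination 2 * h3
  · rintro ⟨k, g, t, h⟩ ⟨k', g', t', h'⟩ - - H
    simp only [Sigma.mk.injEq, heq_eq_eq, Prod.mk.injEq] at H
    obtain ⟨-, ⟨h1, h2⟩, h3, h4⟩ := H
    simp only [Prod.mk.injEq]
    omega
  · rintro ⟨⟨u, v⟩, ⟨p, r⟩, q, s⟩ hx
    simp only [Finset.coe_sigma, Set.mem_sigma_iff, Finset.mem_coe, mem_oddAntidiagonal,
      Finset.mem_product, R, Set.Finite.mem_toFinset] at hx
    obtain ⟨⟨hu, hv, huv⟩, ⟨hp, hpr⟩, hq, hqs⟩ := hx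
    simp only at hp hpr hq hqs
    have hr : Even r := even_of_sq_add_sq hp (by rw [hpr]; exact_mod_cast hu)
    have hs : Even s := even_of_sq_add_sq hq (by rw [hqs]; exact_mod_cast hv)
    obtain ⟨k, hk⟩ := hp.add_odd hq
    obtain ⟨t, ht⟩ := hr.add hs
    obtain rfl : q = k + k - p := by omega
    obtain rfl : s = t + t - r := by omega
    refine ⟨(k, p - k, t, r - t), ⟨?_, ?_, ?_⟩, ?_⟩
    · simpa using hp
    · simpa using hr
    · have : (u : ℤ) + v = 2 * N := by exact_mod_cast huv
      simp only
      linarith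
    · have e1 : k - (p - k) = k + k - p := by ring
      have e2 : t - (r - t) = t + t - r := by ring
      simp only [add_sub_cancel, e1, e2, hpr, hqs, Int.toNat_natCast]

theorem ncard_fourSquares {N : ℕ} (hN : N % 4 = 1) :
    (fourSquares N).ncard = 2 * ∑ d ∈ N.divisors, d := by
  have h1 := sum_ncard_twoSquares_mul (N := N) (by rw [Nat.odd_iff]; omega)
  rw [← ncard_fourSquares_add] at h1
  let σ : ℤ × ℤ × ℤ × ℤ → ℤ × ℤ × ℤ × ℤ := fun v => (v.2.1, v.1, v.2.2)
  have hσ : σ.Injective := by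
    rintro ⟨k, g, t, h⟩ ⟨k', g', t', h'⟩ H
    simp only [σ, Prod.mk.injEq] at H ⊢
    tauto
  have h2 : {v : ℤ × ℤ × ℤ × ℤ | Odd (v.1 + v.2.1) ∧ Even (v.2.2.1 + v.2.2.2) ∧
      v.1 ^ 2 + v.2.1 ^ 2 + v.2.2.1 ^ 2 + v.2.2.2 ^ 2 = N} =
      fourSquares N ∪ σ '' fourSquares N := by
    ext ⟨k, g, t, h⟩
    constructor
    · rintro ⟨h1, h2, h3⟩
      simp only at h1 h2 h3
      have hsq (a b : ℤ) (ha : Even a) (hb : Odd b) (H : a ^ 2 + b ^ 2 + t ^ 2 + h ^ 2 = N) :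
          (a, b, t, h) ∈ fourSquares N := by
        have ht : Even t := by
          obtain ⟨m, hm⟩ := h2
          obtain ⟨a, rfl⟩ := ha
          obtain ⟨b, rfl⟩ := hb
          obtain rfl : h = m + m - t := by omega
          have : Even (t ^ 2) := ⟨(N - 1) / 4 - a ^ 2 - b ^ 2 - b - m ^ 2 + m * t, by
            have : (N : ℤ) = 4 * ((N - 1) / 4) + 1 := by omega
            linarith⟩
          simpa [Int.even_pow] using this
        exact ⟨ha, hb, ht, (Int.even_add.1 h2).1 ht, H⟩
      rcases Int.even_or_odd k with hk | hk
      · exact .inl (hsq k g hk ((Int.odd_add'.1 h1).2 hk) h3)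
      · refine .inr ⟨(g, k, t, h), hsq g k ((Int.odd_add.1 h1).1 hk) hk (by linarith), rfl⟩
    · rintro (⟨h1, h2, h3, h4, h5⟩ | ⟨⟨k', g', t', h'⟩, ⟨h1, h2, h3, h4, h5⟩, ⟨⟩⟩)
      · exact ⟨h1.add_odd h2, h3.add h4, h5⟩
      · exact ⟨h2.add_even h1, h3.add h4, by simp only at h5 ⊢; linarith⟩
  have h3 : Disjoint (fourSquares N) (σ '' fourSquares N) := by
    rw [Set.disjoint_left]
    rintro _ ⟨h1, -⟩ ⟨⟨k, g, t, h⟩, ⟨-, h2, -⟩, rfl⟩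
    exact Int.not_even_iff_odd.2 h2 h1
  rw [h2, Set.ncard_union_eq h3 (finite_fourSquares _) ((finite_fourSquares _).image _),
    Set.ncard_image_of_injective _ hσ] at h1
  omega

end

/-- Representations of `n` as a sum of three squares with only the first one odd. -/
def threeSquares (n : ℤ) : Set (ℤ × ℤ × ℤ) :=
  {v | Odd v.1 ∧ Even v.2.1 ∧ Even v.2.2 ∧ v.1 ^ 2 + v.2.1 ^ 2 + v.2.2 ^ 2 = n}

/-- The elements of `reducedSet n` with vanishing first coordinate. -/
def reducedSlice (n : ℤ) : Set (ℤ × ℤ × ℤ) :=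
  {v | Odd v.1 ∧ Even v.2.1 ∧ Even v.2.2 ∧ |v.2.1| + |v.2.2| < v.1 ∧
    v.1 ^ 2 - v.2.1 ^ 2 - v.2.2 ^ 2 = n}

lemma Set.ncard_eq_sum_ncard_fiber {α β : Type*} {S : Set (α × β)} (hS : S.Finite)
    {F : Finset α} (hF : ∀ x ∈ S, x.1 ∈ F) :
    S.ncard = ∑ a ∈ F, {b | (a, b) ∈ S}.ncard := by
  classical
  rw [Set.ncard_eq_toFinset_card S hS,
    Finset.card_eq_sum_card_fiberwise (f := Prod.fst) (t := F)
      (fun x hx => hF x (by simpa using hx))]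
  refine Finset.sum_congr rfl fun a _ => ?_
  rw [← Set.ncard_coe_finset]
  refine Set.ncard_congr (fun x _ => x.2) ?_ ?_ ?_
  · rintro ⟨a', b⟩ hx
    simp only [Finset.coe_filter, Set.Finite.mem_toFinset, Set.mem_ofPred_eq] at hx ⊢
    rw [← hx.2]; exact hx.1
  · rintro ⟨a₁, b₁⟩ ⟨a₂, b₂⟩ h₁ h₂ hb
    simp only [Finset.coe_filter, Set.Finite.mem_toFinset, Set.mem_ofPred_eq] at h₁ h₂
    exact Prod.ext (h₁.2.trans h₂.2.symm) hb
  · intro b hb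
    exact ⟨(a, b), by simpa using hb, rfl⟩

lemma threeSquares_of_neg {n : ℤ} (hn : n < 0) : threeSquares n = ∅ := by
  rw [Set.eq_empty_iff_forall_notMem]
  rintro ⟨g, t, h⟩ ⟨-, -, -, H⟩
  simp only at H
  nlinarith [sq_nonneg g, sq_nonneg t, sq_nonneg h]

lemma add_sq_lt_sq_of_abs_add_abs_lt {g t h : ℤ} (H : |t| + |h| < g) : t ^ 2 + h ^ 2 < g ^ 2 := by
  have : (|t| + |h|) ^ 2 < g ^ 2 := pow_lt_pow_left₀ H (by positivity) two_ne_zero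
  nlinarith [sq_abs t, sq_abs h, mul_nonneg (abs_nonneg t) (abs_nonneg h)]

lemma reducedSlice_of_neg {n : ℤ} (hn : n < 0) : reducedSlice n = ∅ := by
  rw [Set.eq_empty_iff_forall_notMem]
  rintro ⟨g, t, h⟩ ⟨-, -, -, H, H'⟩
  have := add_sq_lt_sq_of_abs_add_abs_lt H
  simp only at this H'
  omega

lemma sum_ncard_threeSquares {N : ℕ} (hN : N % 4 = 1) :
    ∑ k ∈ Finset.Icc (-(N : ℤ)) N with Even k, (threeSquares (N - k ^ 2)).ncard =
      2 * ∑ d ∈ N.divisors, d := by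
  rw [← ncard_fourSquares hN, Set.ncard_eq_sum_ncard_fiber (finite_fourSquares N)
    (F := {k ∈ Finset.Icc (-(N : ℤ)) N | Even k})]
  · refine Finset.sum_congr rfl fun k hk => congrArg _ ?_
    ext ⟨g, t, h⟩
    rw [Finset.mem_filter] at hk
    simp only [threeSquares, fourSquares, Set.mem_ofPred_eq, hk.2, true_and]
    rw [eq_sub_iff_add_eq]
    ring_nf
  · rintro ⟨k, g, t, h⟩ ⟨hk, -, -, -, H⟩
    simp only at hk H
    rw [Finset.mem_filter, Finset.mem_Icc]
    exact ⟨⟨by nlinarith, by nlinarith⟩, hk⟩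

lemma sum_ncard_reducedSlice {N : ℕ} (hN : N % 4 = 1) :
    ∑ k ∈ Finset.Icc (-(N : ℤ)) N with Even k, (reducedSlice (N - k ^ 2)).ncard =
      ∑ d ∈ N.divisors, d := by
  have hfin : (reducedSet N).Finite := by
    refine Set.finite_of_ncard_pos ?_
    rw [ncard_reducedSet hN]
    exact Finset.sum_pos (fun d hd => Nat.pos_of_mem_divisors hd)
      ⟨1, Nat.one_mem_divisors.2 (by omega)⟩
  rw [← ncard_reducedSet hN, Set.ncard_eq_sum_ncard_fiber hfin
    (F := {k ∈ Finset.Icc (-(N : ℤ)) N | Even k})]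
  · refine Finset.sum_congr rfl fun k hk => congrArg _ ?_
    ext ⟨g, t, h⟩
    rw [Finset.mem_filter] at hk
    simp only [reducedSlice, reducedSet, Set.mem_ofPred_eq, hk.2, true_and]
    rw [eq_sub_iff_add_eq]
    ring_nf
  · rintro ⟨k, g, t, h⟩ ⟨hk, -, -, -, H, H'⟩
    have := add_sq_lt_sq_of_abs_add_abs_lt H
    simp only at hk H' this
    rw [Finset.mem_filter, Finset.mem_Icc]
    exact ⟨⟨by nlinarith, by nlinarith⟩, hk⟩

theorem ncard_threeSquares {n : ℕ} (hn : n % 4 = 1) :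
    (threeSquares n).ncard = 2 * (reducedSlice n).ncard := by
  induction n using Nat.strong_induction_on with
  | _ n ih =>
    have h1 := sum_ncard_threeSquares hn
    have h0 : (0 : ℤ) ∈ (Finset.Icc (-(n : ℤ)) n).filter Even := by simp
    rw [← sum_ncard_reducedSlice hn, ← Finset.add_sum_erase _ _ h0,
      ← Finset.add_sum_erase _ _ h0] at h1
    have h2 : ∀ k ∈ ((Finset.Icc (-(n : ℤ)) n).filter Even).erase 0,
        (threeSquares (n - k ^ 2)).ncard = 2 * (reducedSlice (n - k ^ 2)).ncard := by
      intro k hk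
      rw [Finset.mem_erase, Finset.mem_filter] at hk
      obtain ⟨hk0, -, m, rfl⟩ := hk
      rcases lt_or_ge ((n : ℤ) - (m + m) ^ 2) 0 with h | h
      · rw [threeSquares_of_neg h, reducedSlice_of_neg h]; simp
      · have hm : 0 < (m + m) ^ 2 := by positivity
        have hm4 : (m + m) ^ 2 = 4 * m ^ 2 := by ring
        obtain ⟨j, hj⟩ := Int.eq_ofNat_of_zero_le h
        rw [hj]
        exact ih j (by omega) (by omega)
    rw [Finset.sum_congr rfl h2, ← Finset.mul_sum] at h1
    simp only [ne_eq, OfNat.ofNat_ne_zero, not_false_eq_true, zero_pow, sub_zero] at h1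
    omega

lemma exactly_one_odd {x y z : ℤ} {n : ℕ} (hn : n % 4 = 1) (H : x ^ 2 + y ^ 2 + z ^ 2 = n) :
    (Odd x ∧ Even y ∧ Even z) ∨ (Even x ∧ Odd y ∧ Even z) ∨ (Even x ∧ Even y ∧ Odd z) := by
  have hsq (a : ℤ) : Even a ∧ a ^ 2 % 4 = 0 ∨ Odd a ∧ a ^ 2 % 4 = 1 :=
    (Int.even_or_odd a).imp (fun h => ⟨h, Int.emod_eq_zero_of_dvd (by
      obtain ⟨b, rfl⟩ := h; exact ⟨b ^ 2, by ring⟩)⟩) fun h => ⟨h, Int.sq_mod_four_eq_one_of_odd h⟩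
  rcases hsq x with ⟨hx, hx'⟩ | ⟨hx, hx'⟩ <;> rcases hsq y with ⟨hy, hy'⟩ | ⟨hy, hy'⟩ <;>
    rcases hsq z with ⟨hz, hz'⟩ | ⟨hz, hz'⟩ <;> first | (exfalso; omega) | tauto

theorem r3_eq_three_mul_ncard_threeSquares {n : ℕ} (hn : n % 4 = 1) :
    r3 n = 3 * (threeSquares n).ncard := by
  have hS : {v : ℤ × ℤ × ℤ | v.1 ^ 2 + v.2.1 ^ 2 + v.2.2 ^ 2 = (n : ℤ)}.Finite := by
    have hf := Set.finite_Icc (-(n : ℤ)) n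
    refine (hf.prod (hf.prod hf)).subset ?_
    rintro ⟨a, b, c⟩ h
    simp only [Set.mem_ofPred_eq] at h
    simp only [Set.mem_prod, Set.mem_Icc]
    refine ⟨⟨?_, ?_⟩, ⟨?_, ?_⟩, ?_, ?_⟩ <;> nlinarith [sq_nonneg a, sq_nonneg b, sq_nonneg c]
  rw [r3, Set.ncard_eq_toFinset_card _ hS]
  set S := hS.toFinset
  have hmem (x y z : ℤ) : (x, y, z) ∈ S ↔ x ^ 2 + y ^ 2 + z ^ 2 = n := by simp [S]
  have h1 : (threeSquares n).ncard = {v ∈ S | Odd v.1}.card := by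
    rw [← Set.ncard_coe_finset]
    congr 1
    ext ⟨x, y, z⟩
    simp only [threeSquares, Set.mem_ofPred_eq, Finset.coe_filter, hmem]
    constructor
    · rintro ⟨h1, -, -, h2⟩
      exact ⟨h2, h1⟩
    · rintro ⟨h2, h1⟩
      have := exactly_one_odd hn h2
      rw [← Int.not_even_iff_odd] at *
      tauto
  have h2 : {v ∈ S | Odd v.2.1}.card = {v ∈ S | Odd v.1}.card := by
    refine Finset.card_bij' (fun v _ => (v.2.1, v.1, v.2.2)) (fun v _ => (v.2.1, v.1, v.2.2))
      ?_ ?_ (fun _ _ => rfl) (fun _ _ => rfl) <;>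
    · rintro ⟨x, y, z⟩ h
      rw [Finset.mem_filter, hmem] at h ⊢
      exact ⟨by linarith, h.2⟩
  have h3 : {v ∈ S | Odd v.2.2}.card = {v ∈ S | Odd v.1}.card := by
    refine Finset.card_bij' (fun v _ => (v.2.2, v.2.1, v.1)) (fun v _ => (v.2.2, v.2.1, v.1))
      ?_ ?_ (fun _ _ => rfl) (fun _ _ => rfl) <;>
    · rintro ⟨x, y, z⟩ h
      rw [Finset.mem_filter, hmem] at h ⊢
      exact ⟨by linarith, h.2⟩
  have h4 : S.card =
      {v ∈ S | Odd v.1}.card + {v ∈ S | Odd v.2.1}.card + {v ∈ S | Odd v.2.2}.card := by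
    rw [Finset.card_eq_sum_ones, Finset.card_filter, Finset.card_filter, Finset.card_filter,
      ← Finset.sum_add_distrib, ← Finset.sum_add_distrib]
    refine Finset.sum_congr rfl ?_
    rintro ⟨x, y, z⟩ h
    rcases exactly_one_odd hn ((hmem _ _ _).1 h) with ⟨h1, h2, h3⟩ | ⟨h1, h2, h3⟩ | ⟨h1, h2, h3⟩ <;>
      simp [h1, h2, h3, ← Int.not_even_iff_odd]
  omega

/-- Positive triples `(r, s, t)` with `r s + r t + s t = n`. -/
noncomputable def positiveTriples (n : ℕ) : Finset (ℤ × ℤ × ℤ) :=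
  (Finset.Icc 1 (n : ℤ) ×ˢ Finset.Icc 1 (n : ℤ) ×ˢ Finset.Icc 1 (n : ℤ)).filter fun v =>
    v.1 * v.2.1 + v.1 * v.2.2 + v.2.1 * v.2.2 = n

lemma mem_positiveTriples {n : ℕ} {r s t : ℤ} : (r, s, t) ∈ positiveTriples n ↔
    0 < r ∧ 0 < s ∧ 0 < t ∧ r * s + r * t + s * t = n := by
  simp only [positiveTriples, Finset.mem_filter, Finset.mem_product, Finset.mem_Icc]
  constructor
  · rintro ⟨⟨⟨hr, -⟩, ⟨hs, -⟩, ht, -⟩, h⟩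
    exact ⟨by omega, by omega, by omega, h⟩
  · rintro ⟨hr, hs, ht, h⟩
    refine ⟨⟨⟨by omega, ?_⟩, ⟨by omega, ?_⟩, by omega, ?_⟩, h⟩ <;>
      nlinarith [mul_pos hr hs, mul_pos hr ht, mul_pos hs ht]

lemma exactly_one_even {r s t : ℤ} {n : ℕ} (hn : n % 4 = 1) (H : r * s + r * t + s * t = n) :
    (Even r ∧ Odd s ∧ Odd t) ∨ (Odd r ∧ Even s ∧ Odd t) ∨ (Odd r ∧ Odd s ∧ Even t) := by
  have h1 : ¬ (Odd r ∧ Odd s ∧ Odd t) := by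
    rintro ⟨⟨a, rfl⟩, ⟨b, rfl⟩, c, rfl⟩
    have : 4 * (a * b + a * c + b * c + a + b + c) + 3 = (n : ℤ) := by rw [← H]; ring
    omega
  have h2 : ¬ Even (r * s + r * t + s * t) := by
    rw [H, Int.even_iff]
    omega
  simp only [Int.even_add, Int.even_mul, ← Int.not_even_iff_odd] at *
  tauto

lemma card_positiveTriples_eq_three_mul {n : ℕ} (hn : n % 4 = 1) :
    (positiveTriples n).card = 3 * {v ∈ positiveTriples n | Even v.2.2}.card := by
  have h2 : {v ∈ positiveTriples n | Even v.1}.card =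
      {v ∈ positiveTriples n | Even v.2.2}.card := by
    refine Finset.card_bij' (fun v _ => (v.2.2, v.2.1, v.1)) (fun v _ => (v.2.2, v.2.1, v.1))
      ?_ ?_ (fun _ _ => rfl) (fun _ _ => rfl) <;>
    · rintro ⟨x, y, z⟩ h
      rw [Finset.mem_filter, mem_positiveTriples] at h ⊢
      exact ⟨⟨h.1.2.2.1, h.1.2.1, h.1.1, by linarith⟩, h.2⟩
  have h3 : {v ∈ positiveTriples n | Even v.2.1}.card =
      {v ∈ positiveTriples n | Even v.2.2}.card := by
    refine Finset.card_bij' (fun v _ => (v.1, v.2.2, v.2.1)) (fun v _ => (v.1, v.2.2, v.2.1))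
      ?_ ?_ (fun _ _ => rfl) (fun _ _ => rfl) <;>
    · rintro ⟨x, y, z⟩ h
      rw [Finset.mem_filter, mem_positiveTriples] at h ⊢
      exact ⟨⟨h.1.1, h.1.2.2.1, h.1.2.1, by linarith⟩, h.2⟩
  have h4 : (positiveTriples n).card = {v ∈ positiveTriples n | Even v.1}.card +
      {v ∈ positiveTriples n | Even v.2.1}.card + {v ∈ positiveTriples n | Even v.2.2}.card := by
    rw [Finset.card_eq_sum_ones, Finset.card_filter, Finset.card_filter, Finset.card_filter,
      ← Finset.sum_add_distrib, ← Finset.sum_add_distrib]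
    refine Finset.sum_congr rfl ?_
    rintro ⟨x, y, z⟩ h
    rcases exactly_one_even hn (mem_positiveTriples.1 h).2.2.2 with
      ⟨h1, h2, h3⟩ | ⟨h1, h2, h3⟩ | ⟨h1, h2, h3⟩ <;> simp_all [← Int.not_even_iff_odd]
  omega

lemma ncard_strict_triples (n : ℕ) : Set.ncard {p : ℤ × ℤ × ℤ |
      p.1 > p.2.1 ∧ p.2.1 > p.2.2 ∧ p.2.2 > 0 ∧
      p.1 * p.2.1 + p.1 * p.2.2 + p.2.1 * p.2.2 = (n : ℤ)} =
    {v ∈ positiveTriples n | v.2.1 < v.1 ∧ v.2.2 < v.2.1}.card := by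
  rw [← Set.ncard_coe_finset]
  congr 1
  ext ⟨r, s, t⟩
  simp only [Set.mem_ofPred_eq, Finset.coe_filter, mem_positiveTriples]
  constructor
  · rintro ⟨h1, h2, h3, h4⟩
    exact ⟨⟨by omega, by omega, h3, h4⟩, h1, h2⟩
  · rintro ⟨⟨-, -, h3, h4⟩, h1, h2⟩
    exact ⟨h1, h2, h3, h4⟩

lemma ncard_isosceles_pairs (n : ℕ) : Set.ncard {p : ℤ × ℤ |
      1 ≤ p.1 ∧ 1 ≤ p.2 ∧ p.1 ≠ p.2 ∧ p.1 ^ 2 + 2 * p.1 * p.2 = (n : ℤ)} =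
    {v ∈ positiveTriples n | v.1 = v.2.1 ∧ v.1 ≠ v.2.2}.card := by
  rw [← Set.ncard_coe_finset]
  refine Set.ncard_congr (fun p _ => (p.1, p.1, p.2)) ?_ ?_ ?_
  · rintro ⟨r, t⟩ ⟨h1, h2, h3, h4⟩
    simp only [Finset.coe_filter, Set.mem_ofPred_eq, mem_positiveTriples] at *
    exact ⟨⟨by omega, by omega, by omega, by linarith⟩, trivial, h3⟩
  · rintro ⟨r, t⟩ ⟨r', t'⟩ - - H
    simp only [Prod.mk.injEq] at H ⊢
    tauto
  · rintro ⟨r, s, t⟩ h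
    simp only [Finset.coe_filter, Set.mem_ofPred_eq, mem_positiveTriples] at h
    obtain ⟨⟨h1, h2, h3, h4⟩, rfl, h5⟩ := h
    exact ⟨(r, t), ⟨h1, h3, h5, by simp only; linarith⟩, rfl⟩

lemma card_positiveTriples {n : ℕ} (hn : n % 4 = 1) :
    (positiveTriples n).card =
      6 * {v ∈ positiveTriples n | v.2.1 < v.1 ∧ v.2.2 < v.2.1}.card +
      3 * {v ∈ positiveTriples n | v.1 = v.2.1 ∧ v.1 ≠ v.2.2}.card := by
  have hperm (σ : ℤ × ℤ × ℤ → ℤ × ℤ × ℤ) (τ : ℤ × ℤ × ℤ → ℤ × ℤ × ℤ) (hστ : ∀ v, σ (τ v) = v)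
      (hτσ : ∀ v, τ (σ v) = v)
      (hσT : ∀ r s t, σ (r, s, t) ∈ positiveTriples n ↔ (r, s, t) ∈ positiveTriples n)
      (p : ℤ × ℤ × ℤ → Prop) [DecidablePred p] :
      {v ∈ positiveTriples n | p (σ v)}.card = {v ∈ positiveTriples n | p v}.card :=
    Finset.card_equiv ⟨σ, τ, hτσ, hστ⟩ fun ⟨r, s, t⟩ => by simp [hσT]
  have hT {x y z r s t : ℤ} (h1 : (0 < x ∧ 0 < y ∧ 0 < z) ↔ (0 < r ∧ 0 < s ∧ 0 < t))
      (h2 : x * y + x * z + y * z = r * s + r * t + s * t) :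
      (x, y, z) ∈ positiveTriples n ↔ (r, s, t) ∈ positiveTriples n := by
    rw [mem_positiveTriples, mem_positiveTriples, h2]
    tauto
  have hrts (p : ℤ × ℤ × ℤ → Prop) [DecidablePred p] := hperm (fun v => (v.1, v.2.2, v.2.1))
    (fun v => (v.1, v.2.2, v.2.1)) (fun _ => rfl) (fun _ => rfl)
    (fun r s t => hT (by tauto) (by ring)) p
  have hsrt (p : ℤ × ℤ × ℤ → Prop) [DecidablePred p] := hperm (fun v => (v.2.1, v.1, v.2.2))
    (fun v => (v.2.1, v.1, v.2.2)) (fun _ => rfl) (fun _ => rfl)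
    (fun r s t => hT (by tauto) (by ring)) p
  have htsr (p : ℤ × ℤ × ℤ → Prop) [DecidablePred p] := hperm (fun v => (v.2.2, v.2.1, v.1))
    (fun v => (v.2.2, v.2.1, v.1)) (fun _ => rfl) (fun _ => rfl)
    (fun r s t => hT (by tauto) (by ring)) p
  have hstr (p : ℤ × ℤ × ℤ → Prop) [DecidablePred p] := hperm (fun v => (v.2.1, v.2.2, v.1))
    (fun v => (v.2.2, v.1, v.2.1)) (fun _ => rfl) (fun _ => rfl)
    (fun r s t => hT (by tauto) (by ring)) p
  have htrs (p : ℤ × ℤ × ℤ → Prop) [DecidablePred p] := hperm (fun v => (v.2.2, v.1, v.2.1))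
    (fun v => (v.2.1, v.2.2, v.1)) (fun _ => rfl) (fun _ => rfl)
    (fun r s t => hT (by tauto) (by ring)) p
  have h1 := hrts (fun v => v.2.1 < v.1 ∧ v.2.2 < v.2.1)
  have h2 := hsrt (fun v => v.2.1 < v.1 ∧ v.2.2 < v.2.1)
  have h3 := htsr (fun v => v.2.1 < v.1 ∧ v.2.2 < v.2.1)
  have h4 := hstr (fun v => v.2.1 < v.1 ∧ v.2.2 < v.2.1)
  have h5 := htrs (fun v => v.2.1 < v.1 ∧ v.2.2 < v.2.1)
  have h6 := hrts (fun v => v.1 = v.2.1 ∧ v.1 ≠ v.2.2)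
  have h7 := hstr (fun v => v.1 = v.2.1 ∧ v.1 ≠ v.2.2)
  have hsum : (positiveTriples n).card =
      {v ∈ positiveTriples n | v.2.1 < v.1 ∧ v.2.2 < v.2.1}.card +
      {v ∈ positiveTriples n | v.2.2 < v.1 ∧ v.2.1 < v.2.2}.card +
      {v ∈ positiveTriples n | v.1 < v.2.1 ∧ v.2.2 < v.1}.card +
      {v ∈ positiveTriples n | v.2.1 < v.2.2 ∧ v.1 < v.2.1}.card +
      {v ∈ positiveTriples n | v.2.2 < v.2.1 ∧ v.1 < v.2.2}.card +
      {v ∈ positiveTriples n | v.1 < v.2.2 ∧ v.2.1 < v.1}.card +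
      {v ∈ positiveTriples n | v.1 = v.2.1 ∧ v.1 ≠ v.2.2}.card +
      {v ∈ positiveTriples n | v.1 = v.2.2 ∧ v.1 ≠ v.2.1}.card +
      {v ∈ positiveTriples n | v.2.1 = v.2.2 ∧ v.2.1 ≠ v.1}.card := by
    simp only [Finset.card_filter]
    rw [Finset.card_eq_sum_ones]
    simp only [← Finset.sum_add_distrib]
    refine Finset.sum_congr rfl ?_
    rintro ⟨r, s, t⟩ h
    have hne : ¬ (r = s ∧ r = t) := by
      rintro ⟨rfl, rfl⟩
      have := exactly_one_even hn (mem_positiveTriples.1 h).2.2.2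
      rw [← Int.not_even_iff_odd] at this
      tauto
    simp only
    split_ifs <;> omega
  simp only at h1 h2 h3 h4 h5 h6 h7
  omega

lemma ncard_reducedSlice {n : ℕ} (hn : n % 4 = 1) :
    (reducedSlice n).ncard =
      n.divisors.card + 2 * {v ∈ positiveTriples n | Even v.2.2}.card := by
  have hodd {a c u : ℤ} (h : a * c - u ^ 2 = n) (hu : Even u) :
      ∃ g k, a = g + k ∧ c = g - k ∧ Odd g ∧ Even k := by
    obtain ⟨w, rfl⟩ := hu
    have hac : a * c % 4 = 1 := by
      have : a * c = n + 4 * w ^ 2 := by linear_combination h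
      omega
    have hmod : a % 4 = c % 4 ∧ a % 2 = 1 := by
      rw [Int.mul_emod] at hac
      have := Int.emod_nonneg a (by norm_num : (4 : ℤ) ≠ 0)
      have := Int.emod_lt_of_pos a (by norm_num : (0 : ℤ) < 4)
      have := Int.emod_nonneg c (by norm_num : (4 : ℤ) ≠ 0)
      have := Int.emod_lt_of_pos c (by norm_num : (0 : ℤ) < 4)
      rw [← Int.emod_emod_of_dvd a (by norm_num : (2 : ℤ) ∣ 4)]
      generalize a % 4 = x at *
      generalize c % 4 = y at *
      interval_cases x <;> interval_cases y <;> simp_all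
    refine ⟨(a + c) / 2, (a - c) / 2, by omega, by omega, Int.odd_iff.2 ?_, Int.even_iff.2 ?_⟩ <;>
      omega
  have hfin : (reducedSlice n).Finite := by
    have hf := Set.finite_Icc (-(2 * n : ℤ)) (2 * n)
    refine (hf.prod (hf.prod hf)).subset ?_
    rintro ⟨g, u, k⟩ ⟨-, -, -, h1, h2⟩
    simp only at h1 h2
    simp only [Set.mem_prod, Set.mem_Icc, ← abs_le]
    have h3 := abs_nonneg u
    have h4 := abs_nonneg k
    rw [← sq_abs u, ← sq_abs k] at h2
    rw [abs_of_pos (by omega)]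
    generalize |u| = u at *
    generalize |k| = k at *
    obtain ⟨d, hd⟩ : ∃ d, g = u + k + d := ⟨g - u - k, by ring⟩
    subst hd
    have hd : 1 ≤ d := by omega
    refine ⟨?_, ?_, ?_⟩ <;> nlinarith [mul_nonneg h3 h4, mul_nonneg h3 (by omega : 0 ≤ d - 1),
      mul_nonneg h4 (by omega : 0 ≤ d - 1), mul_self_nonneg (d - 1)]
  have h0 : {v ∈ reducedSlice n | v.2.1 = 0}.ncard = n.divisors.card := by
    rw [← Set.ncard_coe_finset]
    refine Set.ncard_congr (fun v _ => (v.1 + v.2.2).toNat) ?_ ?_ ?_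
    · rintro ⟨g, u, k⟩ ⟨⟨-, -, -, h4, h5⟩, h6⟩
      simp only at h4 h5 h6
      subst h6
      rw [abs_zero, zero_add, abs_lt] at h4
      obtain ⟨a, ha⟩ := Int.eq_ofNat_of_zero_le (by omega : 0 ≤ g + k)
      obtain ⟨c, hc⟩ := Int.eq_ofNat_of_zero_le (by omega : 0 ≤ g - k)
      have : a * c = n := by
        zify
        rw [← ha, ← hc]
        linarith
      simp only [Finset.mem_coe, ha, Int.toNat_natCast]
      exact Nat.mem_divisors.2 ⟨⟨c, this.symm⟩, by omega⟩
    · rintro ⟨g, u, k⟩ ⟨g', u', k'⟩ ⟨⟨-, -, -, h4, h5⟩, h6⟩ ⟨⟨-, -, -, h4', h5'⟩, h6'⟩ H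
      simp only at h4 h5 h6 h4' h5' h6' H
      subst h6 h6'
      rw [abs_zero, zero_add, abs_lt] at h4 h4'
      have hgk : g + k = g' + k' := by omega
      have : (g + k) * (g - k) = (g + k) * (g' - k') := by
        nth_rw 2 [hgk]
        linarith
      have := mul_left_cancel₀ (by omega) this
      simp only [Prod.mk.injEq, true_and]
      omega
    · intro d hd
      obtain ⟨⟨e, rfl⟩, hde⟩ := Nat.mem_divisors.1 hd
      have hd0 : 0 < d := Nat.pos_of_ne_zero (left_ne_zero_of_mul hde)
      have he0 : 0 < e := Nat.pos_of_ne_zero (right_ne_zero_of_mul hde)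
      obtain ⟨g, k, hg, hk, hgo, hke⟩ := hodd (a := d) (c := e) (u := 0) (by simp) (by simp)
      refine ⟨(g, 0, k), ⟨⟨hgo, by simp, hke, ?_, ?_⟩, rfl⟩, ?_⟩
      · simp only [abs_zero, zero_add]
        exact abs_lt.2 ⟨by omega, by omega⟩
      · push_cast
        rw [hg, hk]
        ring
      · simp only [← hg, Int.toNat_natCast]
  have hpos : {v ∈ reducedSlice n | 0 < v.2.1}.ncard =
      {v ∈ positiveTriples n | Even v.2.2}.card := by
    rw [← Set.ncard_coe_finset]
    refine Set.ncard_congr (fun v _ => (v.1 + v.2.2 - v.2.1, v.1 - v.2.2 - v.2.1, v.2.1)) ?_ ?_ ?_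
    · rintro ⟨g, u, k⟩ ⟨⟨h1, h2, h3, h4, h5⟩, h6⟩
      simp only at h1 h2 h3 h4 h5 h6
      simp only [Finset.coe_filter, Set.mem_ofPred_eq, mem_positiveTriples]
      have := le_abs_self u
      have := le_abs_self k
      have := neg_abs_le k
      exact ⟨⟨by omega, by omega, h6, by linarith⟩, h2⟩
    · rintro ⟨g, u, k⟩ ⟨g', u', k'⟩ - - H
      simp only [Prod.mk.injEq] at H ⊢
      omega
    · rintro ⟨r, s, t⟩ h
      simp only [Finset.coe_filter, Set.mem_ofPred_eq, mem_positiveTriples] at h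
      obtain ⟨⟨hr, hs, ht, h⟩, hte⟩ := h
      obtain ⟨g, k, hg, hk, hgo, hke⟩ := hodd (a := r + t) (c := s + t) (u := t) (by linarith) hte
      refine ⟨(g, t, k), ⟨⟨hgo, hte, hke, ?_, ?_⟩, ht⟩, ?_⟩
      · have : |k| < g - t := abs_lt.2 ⟨by omega, by omega⟩
        simp only [abs_of_pos ht]
        omega
      · simp only
        have : (g + k) * (g - k) = (r + t) * (s + t) := by rw [hg, hk]
        linarith
      · simp only [Prod.mk.injEq, and_true]
        omega
  have hneg : {v ∈ reducedSlice n | v.2.1 < 0}.ncard =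
      {v ∈ reducedSlice n | 0 < v.2.1}.ncard := by
    refine Set.ncard_congr (fun v _ => (v.1, -v.2.1, v.2.2)) ?_ ?_ ?_
    · rintro ⟨g, u, k⟩ ⟨⟨h1, h2, h3, h4, h5⟩, h6⟩
      exact ⟨⟨h1, h2.neg, h3, by simpa using h4, by simpa using h5⟩, by simpa using h6⟩
    · rintro ⟨g, u, k⟩ ⟨g', u', k'⟩ - - H
      simp only [Prod.mk.injEq] at H ⊢
      omega
    · rintro ⟨g, u, k⟩ ⟨⟨h1, h2, h3, h4, h5⟩, h6⟩
      exact ⟨(g, -u, k), ⟨⟨h1, h2.neg, h3, by simpa using h4, by simpa using h5⟩,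
        by simpa using h6⟩, by simp⟩
  have hU : reducedSlice n = {v ∈ reducedSlice n | v.2.1 = 0} ∪ ({v ∈ reducedSlice n | v.2.1 < 0} ∪
      {v ∈ reducedSlice n | 0 < v.2.1}) := by
    ext v
    simp only [Set.mem_union, Set.mem_ofPred_eq]
    have := lt_trichotomy v.2.1 0
    tauto
  have hf (p : ℤ × ℤ × ℤ → Prop) : {v ∈ reducedSlice n | p v}.Finite :=
    hfin.subset fun _ h => h.1
  rw [hU, Set.ncard_union_eq ?_ (hf _) ((hf _).union (hf _)), Set.ncard_union_eq ?_ (hf _) (hf _),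
    hneg, h0, hpos]
  · ring
  · exact Set.disjoint_left.2 fun v h1 h2 => absurd h1.2 (not_lt.2 h2.2.le)
  · refine Set.disjoint_left.2 fun v h1 h2 => ?_
    have := h1.2
    rcases h2 with h2 | h2 <;> have := h2.2 <;> omega

/-- Proposition 6.1: for `n ≡ 1 (mod 4)`,
`r₃(n) = 6 d(n) + 24 #{(r,s,t) ∈ ℤ³ : r > s > t > 0, rs+rt+st = n}
  + 12 #{(r,t) : r,t ≥ 1, r ≠ t, r² + 2rt = n}`. -/
theorem r3_one_mod_four (n : ℕ) (hn : 0 < n) (h : n % 4 = 1) :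
    r3 n = 6 * n.divisors.card
      + 24 * Set.ncard {p : ℤ × ℤ × ℤ |
          p.1 > p.2.1 ∧ p.2.1 > p.2.2 ∧ p.2.2 > 0 ∧
          p.1 * p.2.1 + p.1 * p.2.2 + p.2.1 * p.2.2 = (n : ℤ)}
      + 12 * Set.ncard {p : ℤ × ℤ |
          1 ≤ p.1 ∧ 1 ≤ p.2 ∧ p.1 ≠ p.2 ∧ p.1 ^ 2 + 2 * p.1 * p.2 = (n : ℤ)} := by
  have h1 := card_positiveTriples h
  have h2 := card_positiveTriples_eq_three_mul h
  rw [r3_eq_three_mul_ncard_threeSquares h, ncard_threeSquares h, ncard_reducedSlice h,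
    ncard_strict_triples, ncard_isosceles_pairs]
  omega
end
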